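/- Let E be an elliptic curve over ℚ without complex multiplication and let p > 37 be a prime number such that the image of ρ_{E,p} is conjugate in GL₂(F_p) to G(p). Then the p-adic valuation v_p(j(E)) of the j-invariant of E is not divisible by 3; in particular, since j(E) is an integer, v_p(j(E)) > 0. -/

import Mathlib

/-!
Setup: the mod-`p` Galois representation attached to an elliptic curve over `ℚ`,
the non-split Cartan subgroup and related subgroups of `GL₂(𝔽_p)`.
-/

open WeierstrassCurve WeierstrassCurve.Affine Matrix

noncomputable section

/-- A fixed algebraic closure `ℚ̄` of `ℚ`. -/
abbrev Qbar : Type := AlgebraicClosure ℚ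

/-- The thirteen rational CM `j`-invariants.  An elliptic curve over `ℚ` has complex
multiplication (equivalently, its geometric endomorphism ring is strictly larger than `ℤ`)
if and only if its `j`-invariant belongs to this set; thus `E.j ∉ CMjInvariants` expresses
that `E` is a non-CM elliptic curve over `ℚ`. -/
def CMjInvariants : Set ℚ :=
  {0, 1728, -3375, 8000, 54000, -32768, 287496, -884736, -12288000, 16581375, -884736000,
    -147197952000, -262537412640768000}

variable (E : WeierstrassCurve ℚ)

open scoped Classical in
/-- The action of `σ ∈ Gal(ℚ̄/ℚ)` on the group `E(ℚ̄)` of `ℚ̄`-points of `E`. -/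
def galAct (σ : Qbar ≃ₐ[ℚ] Qbar) : (E⁄Qbar).Point →+ (E⁄Qbar).Point :=
  Point.map (W' := E) σ.toAlgHom

open scoped Classical in
/-- The subgroup `E[p] ⊆ E(ℚ̄)` of `p`-torsion points. -/
def pTorsion (p : ℕ) : AddSubgroup ((E⁄Qbar).Point) where
  carrier := {P | p • P = 0}
  zero_mem' := smul_zero p
  add_mem' := fun {a b} ha hb => by
    have h : p • (a + b) = p • a + p • b := smul_add p a b
    simp only [Set.mem_setOf_eq] at *
    rw [h, ha, hb, add_zero]
  neg_mem' := fun {a} ha => by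
    have h : p • (-a) = -(p • a) := smul_neg p a
    simp only [Set.mem_setOf_eq] at *
    rw [h, ha, neg_zero]

/-- `ρ` *is* the mod-`p` Galois representation `ρ_{E,p}` of `E`, written in some `𝔽_p`-basis of
`E[p]`: there is an additive (equivalently, `𝔽_p`-linear) isomorphism `e : E[p] ≃ 𝔽_p²` through
which the Galois action on `E[p]` corresponds to the matrix action of `ρ`. -/
def IsModPRep (p : ℕ) (ρ : (Qbar ≃ₐ[ℚ] Qbar) →* GL (Fin 2) (ZMod p)) : Prop :=
  ∃ e : pTorsion E p ≃+ (Fin 2 → ZMod p),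
    ∀ (σ : Qbar ≃ₐ[ℚ] Qbar) (P : pTorsion E p) (hP : galAct E σ P.1 ∈ pTorsion E p),
      e ⟨galAct E σ P.1, hP⟩ = Matrix.mulVec (ρ σ : Matrix (Fin 2) (Fin 2) (ZMod p)) (e P)

/-- The least positive integer which is a quadratic non-residue modulo `p`. -/
def leastNonResidue (p : ℕ) : ℕ :=
  sInf {n : ℕ | 0 < n ∧ ¬∃ x : ZMod p, x ^ 2 = (n : ZMod p)}

/-- `ε ∈ 𝔽_p`: the reduction mod `p` of the least positive quadratic non-residue. -/
def nsEps (p : ℕ) : ZMod p := (leastNonResidue p : ZMod p)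

/-- The non-split Cartan subgroup `C_ns(p) ⊆ GL₂(𝔽_p)` (as a set): invertible matrices of the
form `[[a, εb], [b, a]]`.  (Invertibility forces `(a, b) ≠ (0, 0)`.) -/
def Cns (p : ℕ) : Set (GL (Fin 2) (ZMod p)) :=
  {M | ∃ a b : ZMod p, (M : Matrix (Fin 2) (Fin 2) (ZMod p)) = !![a, nsEps p * b; b, a]}

/-- `C_ns⁺(p)`: the normaliser of the non-split Cartan subgroup in `GL₂(𝔽_p)`. -/
def CnsPlus (p : ℕ) : Subgroup (GL (Fin 2) (ZMod p)) :=
  Subgroup.setNormalizer (Cns p)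

/-- The subgroup `G(p) = {a³ : a ∈ C_ns(p)} ∪ {diag(1,-1)·a³ : a ∈ C_ns(p)}` of `GL₂(𝔽_p)`
(as a set). -/
def Gset (p : ℕ) : Set (GL (Fin 2) (ZMod p)) :=
  {M | (∃ a ∈ Cns p, M = a ^ 3) ∨
    ∃ a ∈ Cns p, (M : Matrix (Fin 2) (Fin 2) (ZMod p)) =
      !![1, 0; 0, -1] * ((a : Matrix (Fin 2) (Fin 2) (ZMod p)) ^ 3)}

/-- The image of `ρ` is conjugate in `GL₂(𝔽_p)` to the subset `S`. -/
def ImageConjTo {p : ℕ} (ρ : (Qbar ≃ₐ[ℚ] Qbar) →* GL (Fin 2) (ZMod p))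
    (S : Set (GL (Fin 2) (ZMod p))) : Prop :=
  ∃ g : GL (Fin 2) (ZMod p), Set.range ρ = (fun x => g * x * g⁻¹) '' S

end



/-- Abstract data of the `x`-coordinate function on a group of points of `y² = x³ + Ax + B`. -/
structure XData {K M : Type*} [Field K] [AddCommGroup M] (A B : K) (X : M → K) : Prop where
  inj : ∀ P Q : M, P ≠ 0 → Q ≠ 0 → (X P = X Q ↔ P = Q ∨ P = -Q)
  sum : ∀ P Q : M, P ≠ 0 → Q ≠ 0 → P ≠ Q → P ≠ -Q →
    (X P - X Q) ^ 2 * (X (P + Q) + X (P - Q)) = 2 * (X P * X Q + A) * (X P + X Q) + 4 * B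
  prod : ∀ P Q : M, P ≠ 0 → Q ≠ 0 → P ≠ Q → P ≠ -Q →
    (X P - X Q) ^ 2 * (X (P + Q) * X (P - Q)) = (X P * X Q - A) ^ 2 - 4 * B * (X P + X Q)
  dbl : ∀ P : M, P ≠ 0 → P ≠ -P →
    4 * (X P ^ 3 + A * X P + B) * X (P + P) = (X P ^ 2 - A) ^ 2 - 8 * B * X P
  ne : ∀ P : M, P ≠ 0 → P ≠ -P → X P ^ 3 + A * X P + B ≠ 0

section seq
variable {K : Type*} [Field K] (x V : ℕ → K) (N : ℕ)

theorem seq_addSub (h0 : V 0 = 0) (h1 : V 1 = 1)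
    (hrec : ∀ m, m + 2 ≤ N → V (m + 2) * V m = V (m + 1) ^ 2 * (x 1 - x (m + 1)))
    (hne : ∀ n, 1 ≤ n → n < N → V n ≠ 0)
    (hs : ∀ n d, 2 ≤ n → 1 ≤ d → 2 * n + d < N →
      (x n - x (n + d)) ^ 2 * ((x 1 - x (2 * n + d)) * (x 1 - x d)) =
      (x 1 - x n) ^ 2 * ((x (n + 1) - x (n + d)) * (x (n - 1) - x (n + d))))
    (hs1 : ∀ d, 1 ≤ d → 2 + d < N →
      (x 1 - x (1 + d)) ^ 2 * ((x 1 - x (2 + d)) * (x 1 - x d)) =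
      V 2 ^ 2 * (x 2 - x (1 + d))) :
    ∀ n d, 2 * (n + 1) + d ≤ N →
      V (2 * (n + 1) + d) * V d = V (n + 1 + d) ^ 2 * V (n + 1) ^ 2 * (x (n + 1) - x (n + 1 + d)) := by
  intro n
  induction n using Nat.strong_induction_on with
  | _ n ih =>
  intro d hd
  rcases Nat.eq_zero_or_pos d with rfl | hd0
  · simp [h0]
  rcases n with _ | _ | k
  · have := hrec d (by omega)
    rw [show 2 * (0 + 1) + d = d + 2 by ring, this, show 0 + 1 + d = d + 1 by ring]
    simp [h1]
  · -- n = 2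
    have a1 := hrec (2 + d) (by omega)
    have a2 := hrec d (by omega)
    have a3 := hs1 (d + 1) (by omega) (by omega)
    have a4 := ih 0 (by omega) (d + 1) (by omega)
    have e1 := hne (2 + d) (by omega) (by omega)
    simp only [show 2 * (0 + 1) + (d + 1) = d + 3 by ring, show 0 + 1 + (d + 1) = d + 2 by ring,
      show 0 + 1 = 1 by rfl, show 1 + (d + 1) = d + 2 by ring, show 2 + (d + 1) = d + 3 by ring,
      show 2 * (1 + 1) + d = d + 4 by ring, show 1 + 1 + d = d + 2 by ring,
      show 2 + d + 2 = d + 4 by ring, show 2 + d + 1 = d + 3 by ring,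
      show 2 + d = d + 2 by ring, show 1 + 1 = 2 by rfl, h1] at *
    refine mul_right_cancel₀ (pow_ne_zero 2 e1) ?_
    calc V (d + 4) * V d * V (d + 2) ^ 2 = (V (d+4) * V (d+2)) * (V (d+2) * V d) := by ring
      _ = (V (d+3) * V (d+1)) ^ 2 * ((x 1 - x (d + 3)) * (x 1 - x (d+1))) := by rw [a1, a2]; ring
      _ = V (d+2) ^ 4 * ((x 1 - x (d + 2)) ^ 2 * ((x 1 - x (d + 3)) * (x 1 - x (d+1)))) := by
          rw [a4]; ring
      _ = _ := by rw [a3]; ring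
  · have a1 := hrec (2 * k + d + 4) (by omega)
    have a2 := hrec d (by omega)
    have a3 := hs (k + 2) (d + 1) (by omega) (by omega) (by omega)
    have a4 := ih (k + 1) (by omega) (d + 1) (by omega)
    have a5 := ih k (by omega) (d + 2) (by omega)
    have a6 := hrec (k + 1) (by omega)
    have e1 := hne (2 * k + d + 4) (by omega) (by omega)
    have e2 := hne (d + 2) (by omega) (by omega)
    simp only [show k + 2 - 1 = k + 1 by rfl, show 2 * (k + 1 + 1 + 1) + d = 2 * k + d + 6 by ring,
      show 2 * (k + 1 + 1) + (d + 1) = 2 * k + d + 5 by ring,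
      show 2 * (k + 2) + (d + 1) = 2 * k + d + 5 by ring,
      show 2 * (k + 1) + (d + 2) = 2 * k + d + 4 by ring,
      show 2 * k + d + 4 + 2 = 2 * k + d + 6 by ring,
      show 2 * k + d + 4 + 1 = 2 * k + d + 5 by ring,
      show k + 2 + (d + 1) = k + d + 3 by ring,
      show k + 1 + 1 + (d + 1) = k + d + 3 by ring,
      show k + 1 + 1 + 1 + d = k + d + 3 by ring,
      show k + 1 + (d + 2) = k + d + 3 by ring,
      show k + 1 + 1 + 1 = k + 3 by ring, show k + 1 + 1 = k + 2 by ring,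
      show k + 2 + 1 = k + 3 by ring, show k + 1 + 2 = k + 3 by ring] at *
    refine mul_right_cancel₀ (mul_ne_zero e1 e2) ?_
    calc V (2 * k + d + 6) * V d * (V (2 * k + d + 4) * V (d + 2))
        = (V (2 * k + d + 6) * V (2 * k + d + 4)) * (V (d + 2) * V d) := by ring
      _ = (V (2 * k + d + 5) * V (d + 1)) ^ 2 *
          ((x 1 - x (2 * k + d + 5)) * (x 1 - x (d + 1))) := by rw [a1, a2]; ring
      _ = V (k + d + 3) ^ 4 * V (k + 2) ^ 4 * ((x (k + 2) - x (k + d + 3)) ^ 2 *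
          ((x 1 - x (2 * k + d + 5)) * (x 1 - x (d + 1)))) := by rw [a4]; ring
      _ = V (k + d + 3) ^ 4 * (V (k + 2) ^ 2 * (x 1 - x (k + 2))) ^ 2 *
          ((x (k + 3) - x (k + d + 3)) * (x (k + 1) - x (k + d + 3))) := by rw [a3]; ring
      _ = _ := by rw [← a6, a5]; ring

theorem seq_normEDS (c d : K) (h0 : V 0 = 0) (h1 : V 1 = 1) (h3 : V 3 = c) (h4 : V 4 = d * V 2)
    (hb : V 2 ≠ 0)
    (hrec : ∀ m, m + 2 ≤ N → V (m + 2) * V m = V (m + 1) ^ 2 * (x 1 - x (m + 1)))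
    (hA : ∀ n d, 2 * (n + 1) + d ≤ N →
      V (2 * (n + 1) + d) * V d = V (n + 1 + d) ^ 2 * V (n + 1) ^ 2 * (x (n + 1) - x (n + 1 + d))) :
    ∀ n : ℕ, n ≤ N → V n = normEDS (V 2) c d n := by
  intro n
  induction n using normEDSRec' with
  | zero => simp [h0]
  | one => simp [h1]
  | two => intro _; exact (normEDS_two _ _ _).symm
  | three => intro _; rw [h3]; exact (normEDS_three _ _ _).symm
  | four => intro _; rw [h4]; exact (normEDS_four _ _ _).symm
  | even m ih =>
    intro hm
    have e := normEDS_even (V 2) c d ((m + 3 : ℕ) : ℤ)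
    have f1 := ih (m + 1) (by omega) (by omega)
    have f2 := ih (m + 2) (by omega) (by omega)
    have f3 := ih (m + 3) (by omega) (by omega)
    have f4 := ih (m + 4) (by omega) (by omega)
    have f5 := ih (m + 5) (by omega) (by omega)
    rw [show (((m + 3 : ℕ) : ℤ)) - 1 = ((m + 2 : ℕ) : ℤ) by push_cast; ring,
      show (((m + 3 : ℕ) : ℤ)) + 2 = ((m + 5 : ℕ) : ℤ) by push_cast; ring,
      show (((m + 3 : ℕ) : ℤ)) - 2 = ((m + 1 : ℕ) : ℤ) by push_cast; ring,
      show (((m + 3 : ℕ) : ℤ)) + 1 = ((m + 4 : ℕ) : ℤ) by push_cast; ring,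
      ← f1, ← f2, ← f3, ← f4, ← f5] at e
    have a := hA (m + 1) 2 (by omega)
    have b1 := hrec (m + 3) (by omega)
    have b2 := hrec (m + 1) (by omega)
    rw [show 2 * (m + 1 + 1) + 2 = 2 * (m + 3) by ring] at a
    refine mul_right_cancel₀ hb ?_
    rw [a, show ((2 * (m + 3) : ℕ) : ℤ) = 2 * ((m + 3 : ℕ) : ℤ) by push_cast; ring, e]
    simp only [show m + 3 + 2 = m + 5 by rfl, show m + 3 + 1 = m + 4 by rfl,
      show m + 1 + 2 = m + 3 by rfl, show m + 1 + 1 = m + 2 by rfl, show m + 1 + 1 + 2 = m + 4 by rfl,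
      show m + 2 + 2 = m + 4 by rfl] at *
    linear_combination (-V (m+2)^2) * b1 + V (m+4)^2 * b2
  | odd m ih =>
    intro hm
    have e := normEDS_odd (V 2) c d ((m + 2 : ℕ) : ℤ)
    have f1 := ih (m + 1) (by omega) (by omega)
    have f2 := ih (m + 2) (by omega) (by omega)
    have f3 := ih (m + 3) (by omega) (by omega)
    have f4 := ih (m + 4) (by omega) (by omega)
    rw [show (((m + 2 : ℕ) : ℤ)) - 1 = ((m + 1 : ℕ) : ℤ) by push_cast; ring,
      show (((m + 2 : ℕ) : ℤ)) + 2 = ((m + 4 : ℕ) : ℤ) by push_cast; ring,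
      show (((m + 2 : ℕ) : ℤ)) + 1 = ((m + 3 : ℕ) : ℤ) by push_cast; ring,
      ← f1, ← f2, ← f3, ← f4] at e
    have a := hA (m + 1) 1 (by omega)
    have b1 := hrec (m + 2) (by omega)
    have b2 := hrec (m + 1) (by omega)
    rw [show 2 * (m + 1 + 1) + 1 = 2 * (m + 2) + 1 by ring, h1, mul_one] at a
    rw [a, show ((2 * (m + 2) + 1 : ℕ) : ℤ) = 2 * ((m + 2 : ℕ) : ℤ) + 1 by push_cast; ring, e]
    simp only [show m + 2 + 2 = m + 4 by rfl, show m + 2 + 1 = m + 3 by rfl,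
      show m + 1 + 2 = m + 3 by rfl, show m + 1 + 1 = m + 2 by rfl, show m + 1 + 1 + 1 = m + 3 by rfl] at *
    linear_combination (-V (m+2)^2) * b1 + V (m+3)^2 * b2
end seq


noncomputable section
/-- The auxiliary sequence of values of division polynomials. -/
def Vseq {K : Type*} [Field K] (x : ℕ → K) (b : K) : ℕ → K
  | 0 => 0
  | 1 => 1
  | 2 => b
  | (n + 3) => (x 1 - x (n + 2)) * Vseq x b (n + 2) ^ 2 / Vseq x b (n + 1)
end

section
variable {K M : Type*} [Field K] [AddCommGroup M] {A B : K} {X : M → K}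

theorem nsmul_ne_zero_of_prime {p : ℕ} (hp : p.Prime) {P : M} (hP : P ≠ 0) (hpP : p • P = 0)
    {n : ℕ} (h1 : 1 ≤ n) (h2 : n < p) : n • P ≠ 0 := by
  intro h
  have d1 : addOrderOf P ∣ p := addOrderOf_dvd_of_nsmul_eq_zero hpP
  have d2 : addOrderOf P ∣ n := addOrderOf_dvd_of_nsmul_eq_zero h
  have : addOrderOf P ∣ 1 := by
    rw [← Nat.Coprime.gcd_eq_one ((Nat.Prime.coprime_iff_not_dvd hp).2
      (fun hd => absurd (Nat.le_of_dvd (by omega) hd) (by omega)) : p.Coprime n)]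
    exact Nat.dvd_gcd d1 d2
  rw [Nat.dvd_one, AddMonoid.addOrderOf_eq_one_iff] at this
  exact hP this

theorem XData.preΨ'_root [IsAlgClosed K] (h2 : (2 : K) ≠ 0) (hX : XData A B X) {p : ℕ}
    (hp : p.Prime) (hp3 : 3 < p) {P : M} (hP : P ≠ 0) (hpP : p • P = 0) :
    ((⟨0, 0, 0, A, B⟩ : WeierstrassCurve K).preΨ' p).eval (X P) = 0 := by
  have hp4 : 4 < p := by
    rcases Nat.lt_or_ge 4 p with h | h
    · exact h
    · have : p = 4 := by omega
      subst this; revert hp; decide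
  have nz : ∀ n, 1 ≤ n → n < p → n • P ≠ 0 := fun n h1 h2 => nsmul_ne_zero_of_prime hp hP hpP h1 h2
  have dist : ∀ i j, 1 ≤ j → j < i → i < p → i • P ≠ j • P := by
    intro i j h1 h2 h3 h
    apply nz (i - j) (by omega) (by omega)
    rw [sub_nsmul _ h2.le, h]; simp
  have dist' : ∀ i j, 1 ≤ i + j → i + j < p → i • P ≠ -(j • P) := by
    intro i j h1 h2 h
    apply nz (i + j) (by omega) (by omega)
    rw [add_nsmul, h]; simp
  set x : ℕ → K := fun n => X (n • P) with hx
  have x1 : x 1 = X P := by simp [hx]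
  have S : ∀ i j, 1 ≤ j → j < i → i + j < p →
      (x i - x j) ^ 2 * (x (i + j) + x (i - j)) = 2 * (x i * x j + A) * (x i + x j) + 4 * B := by
    intro i j h1 h2 h3
    have := hX.sum (i • P) (j • P) (nz i (by omega) (by omega)) (nz j (by omega) (by omega))
      (dist i j h1 h2 (by omega)) (dist' i j (by omega) h3)
    rw [← add_nsmul, show i • P - j • P = (i - j) • P by rw [sub_nsmul _ h2.le, sub_eq_add_neg]] at this
    exact this
  have T : ∀ i j, 1 ≤ j → j < i → i + j < p →
      (x i - x j) ^ 2 * (x (i + j) * x (i - j)) = (x i * x j - A) ^ 2 - 4 * B * (x i + x j) := by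
    intro i j h1 h2 h3
    have := hX.prod (i • P) (j • P) (nz i (by omega) (by omega)) (nz j (by omega) (by omega))
      (dist i j h1 h2 (by omega)) (dist' i j (by omega) h3)
    rw [← add_nsmul, show i • P - j • P = (i - j) • P by rw [sub_nsmul _ h2.le, sub_eq_add_neg]] at this
    exact this
  have hPP : P ≠ -P := by simpa using dist' 1 1 (by omega) (by omega)
  have D : 4 * (x 1 ^ 3 + A * x 1 + B) * x 2 = (x 1 ^ 2 - A) ^ 2 - 8 * B * x 1 := by
    have := hX.dbl P hP hPP
    simpa only [hx, two_nsmul, one_nsmul] using this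
  have F : x 1 ^ 3 + A * x 1 + B ≠ 0 := by
    have := hX.ne P hP hPP
    simpa only [hx, one_nsmul] using this
  obtain ⟨η, hη⟩ := IsAlgClosed.exists_pow_nat_eq (x 1 ^ 3 + A * x 1 + B) (n := 2) (by norm_num)
  have hη0 : η ≠ 0 := by rintro rfl; apply F; rw [← hη]; simp
  set b := 2 * η with hb
  have hb0 : b ≠ 0 := mul_ne_zero h2 hη0
  have hb2 : b ^ 2 = 4 * (x 1 ^ 3 + A * x 1 + B) := by rw [hb, ← hη]; ring
  have xne : ∀ n, 2 ≤ n → n + 1 < p → x 1 - x n ≠ 0 := by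
    intro n h1 h2 h
    rcases (hX.inj P (n • P) hP (nz n (by omega) (by omega))).1
      (by rw [← x1]; exact sub_eq_zero.1 h) with h | h
    · exact dist n 1 le_rfl (by omega) (by omega) (by simpa using h.symm)
    · exact dist' 1 n (by omega) (by omega) (by simpa using h)
  set V := Vseq x b with hV
  have V0 : V 0 = 0 := by rw [hV, Vseq]
  have V1 : V 1 = 1 := by rw [hV, Vseq]
  have V2 : V 2 = b := by rw [hV, Vseq]
  have V3' : ∀ n, V (n + 3) = (x 1 - x (n + 2)) * V (n + 2) ^ 2 / V (n + 1) := by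
    intro n; rw [hV, Vseq]
  have Vne : ∀ n, 1 ≤ n → n < p → V n ≠ 0 := by
    intro n
    induction n using Nat.strong_induction_on with
    | _ n ih =>
    intro h1 h2
    rcases n with _ | _ | _ | n
    · omega
    · rw [V1]; exact one_ne_zero
    · rw [V2]; exact hb0
    · rw [V3']
      exact div_ne_zero (mul_ne_zero (xne _ (by omega) (by omega))
        (pow_ne_zero 2 (ih _ (by omega) (by omega) (by omega)))) (ih _ (by omega) (by omega) (by omega))
  have hrec : ∀ m, m + 2 ≤ p → V (m + 2) * V m = V (m + 1) ^ 2 * (x 1 - x (m + 1)) := by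
    intro m hm
    rcases m with _ | m
    · simp [V0]
    · rw [show m + 1 + 2 = m + 3 by rfl, V3', div_mul_cancel₀ _ (Vne _ (by omega) (by omega))]
      ring
  have hA := seq_addSub x V p V0 V1 hrec Vne
    (by
      intro n d h1 h2 h3
      have s1 := S (n + d) n (by omega) (by omega) (by omega)
      have t1 := T (n + d) n (by omega) (by omega) (by omega)
      have s2 := S n 1 (by omega) (by omega) (by omega)
      have t2 := T n 1 (by omega) (by omega) (by omega)
      rw [show n + d + n = 2 * n + d by ring, show n + d - n = d by omega] at s1 t1
      linear_combination (-x 1) * s1 + t1 + x (n + d) * s2 - t2)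
    (by
      intro d h1 h2
      have s1 := S (1 + d) 1 (by omega) (by omega) (by omega)
      have t1 := T (1 + d) 1 (by omega) (by omega) (by omega)
      rw [show 1 + d + 1 = 2 + d by ring, show 1 + d - 1 = d by omega] at s1 t1
      rw [V2, hb2]
      linear_combination (-x 1) * s1 + t1 - D)
  have hV3 : V 3 = 3 * x 1 ^ 4 + 6 * A * x 1 ^ 2 + 12 * B * x 1 - A ^ 2 := by
    rw [show (3 : ℕ) = 0 + 3 by rfl, V3', show 0 + 1 = 1 by rfl, show 0 + 2 = 2 by rfl, V1, V2, hb2]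
    linear_combination - D
  have hV4 : V 4 = (2 * x 1 ^ 6 + 10 * A * x 1 ^ 4 + 40 * B * x 1 ^ 3 - 10 * A ^ 2 * x 1 ^ 2
      - 8 * A * B * x 1 - 2 * A ^ 3 - 16 * B ^ 2) * V 2 := by
    refine mul_right_cancel₀ (b := V 2) (by rw [V2]; exact hb0) ?_
    have e1 := hrec 2 (by omega)
    have e3 : V 3 = b ^ 2 * (x 1 - x 2) := by
      rw [show (3 : ℕ) = 0 + 3 by rfl, V3', show 0 + 1 = 1 by rfl, show 0 + 2 = 2 by rfl, V1, V2]
      ring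
    have s := S 2 1 (by omega) (by omega) (by omega)
    norm_num at e1 s
    rw [e1, V2]
    rw [show ((2 * x 1 ^ 6 + 10 * A * x 1 ^ 4 + 40 * B * x 1 ^ 3 - 10 * A ^ 2 * x 1 ^ 2
      - 8 * A * B * x 1 - 2 * A ^ 3 - 16 * B ^ 2) * b * b) = (2 * x 1 ^ 6 + 10 * A * x 1 ^ 4 + 40 * B * x 1 ^ 3 - 10 * A ^ 2 * x 1 ^ 2
      - 8 * A * B * x 1 - 2 * A ^ 3 - 16 * B ^ 2) * b ^ 2 by ring]
    have : V 3 ^ 2 * (x 1 - x 3) = (b ^ 2) ^ 2 * (2 * x 1 * (x 1 - x 2) ^ 2 -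
        (2 * (x 2 * x 1 + A) * (x 2 + x 1) + 4 * B)) := by
      rw [e3]; linear_combination (-(b ^ 2) ^ 2) * s
    rw [this]
    have D' : b ^ 2 * x 2 = (x 1 ^ 2 - A) ^ 2 - 8 * B * x 1 := by rw [hb2]; exact D
    have : (b ^ 2) ^ 2 * (2 * x 1 * (x 1 - x 2) ^ 2 -
        (2 * (x 2 * x 1 + A) * (x 2 + x 1) + 4 * B)) =
        2 * x 1 * (b ^ 2 * x 1 - b ^ 2 * x 2) ^ 2 -
        (2 * (b ^ 2 * x 2 * x 1 + b ^ 2 * A) * (b ^ 2 * x 2 + b ^ 2 * x 1) + 4 * B * (b ^ 2) ^ 2) := by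
      ring
    rw [this, D', hb2]
    ring
  have key := seq_normEDS x V p _ _ V0 V1 hV3 hV4 (by rw [V2]; exact hb0) hrec hA p le_rfl
  have Vp : V p = 0 := by
    obtain ⟨n, rfl⟩ : ∃ n, p = n + 3 := ⟨p - 3, by omega⟩
    rw [V3']
    have : x 1 = x (n + 2) := by
      rw [x1]
      refine (hX.inj P ((n + 2) • P) hP (nz _ (by omega) (by omega))).2 (Or.inr ?_)
      rw [eq_neg_iff_add_eq_zero, ← hpP]
      module
    simp [this]
  rw [Vp, normEDS_ofNat, if_neg, mul_one] at key
  · refine Eq.trans ?_ key.symm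
    rw [WeierstrassCurve.preΨ', ← Polynomial.coe_evalRingHom, map_preNormEDS', ← x1, V2]
    congr 1
    · rw [show b ^ 4 = (b ^ 2) ^ 2 by ring, hb2]
      simp [WeierstrassCurve.Ψ₂Sq, WeierstrassCurve.b₂, WeierstrassCurve.b₄, WeierstrassCurve.b₆]
      ring
    · simp [WeierstrassCurve.Ψ₃, WeierstrassCurve.b₂, WeierstrassCurve.b₄, WeierstrassCurve.b₆, WeierstrassCurve.b₈]
      ring
    · simp [WeierstrassCurve.preΨ₄, WeierstrassCurve.b₂, WeierstrassCurve.b₄, WeierstrassCurve.b₆, WeierstrassCurve.b₈]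
      ring
  · rw [Nat.not_even_iff_odd]; exact hp.odd_of_ne_two (by omega)
end


section um
variable {K : Type*} [NormedField K] [IsUltrametricDist K] {a b : K} {r : ℝ}

theorem um_add (ha : ‖a‖ ≤ r) (hb : ‖b‖ ≤ r) : ‖a + b‖ ≤ r :=
  (IsUltrametricDist.norm_add_le_max a b).trans (max_le ha hb)
theorem um_sub (ha : ‖a‖ ≤ r) (hb : ‖b‖ ≤ r) : ‖a - b‖ ≤ r := by
  rw [sub_eq_add_neg]; exact um_add ha (by rwa [norm_neg])
theorem um_add_lt (ha : ‖a‖ < r) (hb : ‖b‖ < r) : ‖a + b‖ < r :=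
  (IsUltrametricDist.norm_add_le_max a b).trans_lt (max_lt ha hb)
theorem um_sub_lt (ha : ‖a‖ < r) (hb : ‖b‖ < r) : ‖a - b‖ < r := by
  rw [sub_eq_add_neg]; exact um_add_lt ha (by rwa [norm_neg])
theorem um_mul (ha : ‖a‖ ≤ 1) (hb : ‖b‖ ≤ 1) : ‖a * b‖ ≤ 1 := by
  rw [norm_mul]; exact mul_le_one₀ ha (norm_nonneg _) hb
theorem um_mul_lt (ha : ‖a‖ ≤ 1) (hb : ‖b‖ < 1) : ‖a * b‖ < 1 := by
  rw [norm_mul]; exact (mul_le_of_le_one_left (norm_nonneg _) ha).trans_lt hb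
theorem um_mul_lt' (ha : ‖a‖ < 1) (hb : ‖b‖ ≤ 1) : ‖a * b‖ < 1 := by
  rw [mul_comm]; exact um_mul_lt hb ha
theorem um_pow (ha : ‖a‖ ≤ 1) (n : ℕ) : ‖a ^ n‖ ≤ 1 := by
  rw [norm_pow]; exact pow_le_one₀ (norm_nonneg _) ha
theorem um_add_eq (ha : ‖b‖ < ‖a‖) : ‖a + b‖ = ‖a‖ := by
  rw [IsUltrametricDist.norm_add_eq_max_of_norm_ne_norm ha.ne', max_eq_left ha.le]
theorem um_sub_eq (ha : ‖b‖ < ‖a‖) : ‖a - b‖ = ‖a‖ := by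
  rw [sub_eq_add_neg]; exact um_add_eq (by rwa [norm_neg])
theorem um_nat (n : ℕ) [n.AtLeastTwo] : ‖(OfNat.ofNat n : K)‖ ≤ 1 := by
  rw [← Nat.cast_ofNat]; exact IsUltrametricDist.norm_natCast_le_one K _

theorem norm_preNormEDS'_zero {c d : K} (hc : ‖c‖ = 1) (n : ℕ) :
    Odd n → ‖preNormEDS' 0 c d n‖ = 1 := by
  induction n using normEDSRec' with
  | zero => intro h; exact absurd h (by decide)
  | one => simp
  | two => intro h; exact absurd h (by decide)
  | three => simpa using fun _ => hc
  | four => intro h; exact absurd h (by decide)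
  | even m ih => intro h; exact absurd h (by rw [Nat.not_odd_iff_even]; exact even_two_mul _)
  | odd m ih =>
    intro _
    rw [preNormEDS'_odd]
    rcases Nat.even_or_odd m with h | h
    · have h1 := ih (m + 1) (by omega) h.add_one
      have h3 := ih (m + 3) (by omega) (h.add_odd (by decide))
      simp [h, h1, h3]
    · have h1 := ih (m + 2) (by omega) (h.add_even (by decide))
      have h3 := ih (m + 4) (by omega) (h.add_even (by decide))
      simp [Nat.not_even_iff_odd.2 h, h1, h3]

theorem norm_preNormEDS'_le {b c d : K} (hb : ‖b‖ ≤ 1) (hc : ‖c‖ ≤ 1) (hd : ‖d‖ ≤ 1) (n : ℕ) :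
    ‖preNormEDS' b c d n‖ ≤ 1 := by
  induction n using normEDSRec with
  | zero => simp
  | one => simp
  | two => simp
  | three => simpa using hc
  | four => simpa using hd
  | even m h1 h2 h3 h4 h5 =>
    rw [preNormEDS'_even]
    exact um_sub (um_mul (um_mul (um_pow h2 _) h3) h5) (um_mul (um_mul h1 h3) (um_pow h4 _))
  | odd m h1 h2 h3 h4 =>
    rw [preNormEDS'_odd]
    refine um_sub (um_mul (um_mul h4 (um_pow h2 _)) ?_) (um_mul (um_mul h1 (um_pow h3 _)) ?_) <;>
    split_ifs <;> simp [hb]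

theorem exists_cubic_root [IsAlgClosed K] (A B : K) : ∃ e : K, e ^ 3 + A * e + B = 0 := by
  have hd : (Polynomial.X ^ 3 + Polynomial.C A * Polynomial.X + Polynomial.C B : Polynomial K).degree = 3 := by
    compute_degree!
  obtain ⟨e, he⟩ := IsAlgClosed.exists_root (Polynomial.X ^ 3 + Polynomial.C A * Polynomial.X + Polynomial.C B : Polynomial K) (by rw [hd]; norm_num)
  exact ⟨e, by simpa [Polynomial.IsRoot] using he⟩

theorem norm_cubic_root_le {A B e : K} (hA : ‖A‖ ≤ 1) (hB : ‖B‖ ≤ 1)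
    (he : e ^ 3 + A * e + B = 0) : ‖e‖ ≤ 1 := by
  by_contra! h
  have h1 : ‖A * e + B‖ ≤ ‖e‖ := um_add (by rw [norm_mul]; exact mul_le_of_le_one_left (norm_nonneg _) hA) (hB.trans h.le)
  have h2 : ‖e‖ < ‖e ^ 3‖ := by
    rw [norm_pow]; exact lt_self_pow₀ h (by norm_num)
  have := um_add_eq (h1.trans_lt h2)
  rw [← add_assoc, he, norm_zero] at this
  linarith [norm_nonneg e]

/-- Reduction type of the model `y² = x³ + Ax + B`. -/
def RedType (A B c : K) : Prop :=
  ‖4 * A ^ 3 + 27 * B ^ 2‖ = 1 ∨ (A = -3 * c ^ 2 ∧ ‖c‖ = 1 ∧ ‖B - 2 * c ^ 3‖ < 1)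

theorem exists_good_root [IsAlgClosed K] {A B c : K} (hA : ‖A‖ ≤ 1) (hB : ‖B‖ ≤ 1) (h3 : ‖(3 : K)‖ = 1)
    (hred : RedType A B c) :
    ∃ e : K, e ^ 3 + A * e + B = 0 ∧ ‖e‖ ≤ 1 ∧ ‖3 * e ^ 2 + A‖ = 1 := by
  rcases hred with h | ⟨rfl, hc, hδ⟩
  · obtain ⟨e, he⟩ := exists_cubic_root A B
    have he1 := norm_cubic_root_le hA hB he
    refine ⟨e, he, he1, ?_⟩
    have hle : ‖3 * e ^ 2 + A‖ ≤ 1 := um_add (um_mul h3.le (um_pow he1 _)) hA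
    refine le_antisymm hle ?_
    have e1 : 4 * A ^ 3 + 27 * B ^ 2 = (3 * e ^ 2 + A) * ((3 * e ^ 2 + A) * (4 * A + 3 * e ^ 2)) := by
      have : B = -e ^ 3 - A * e := by linear_combination he
      rw [this]; ring
    rw [e1, norm_mul] at h
    have : ‖(3 * e ^ 2 + A) * (4 * A + 3 * e ^ 2)‖ ≤ 1 :=
      um_mul hle (um_add (um_mul (um_nat 4) hA) (um_mul h3.le (um_pow he1 _)))
    nlinarith [norm_nonneg (3 * e ^ 2 + A)]
  · set A := -3 * c ^ 2 with hAdef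
    obtain ⟨e1, he1⟩ := exists_cubic_root A B
    have hd : (Polynomial.X ^ 2 + Polynomial.C e1 * Polynomial.X + Polynomial.C (e1 ^ 2 + A) : Polynomial K).degree = 2 := by
      compute_degree!
    obtain ⟨e2, he2⟩ := IsAlgClosed.exists_root _ (by rw [hd]; norm_num)
    have he2 : e2 ^ 2 + e1 * e2 + (e1 ^ 2 + A) = 0 := by simpa [Polynomial.IsRoot] using he2
    have r2 : e2 ^ 3 + A * e2 + B = 0 := by linear_combination (e2 - e1) * he2 + he1
    have r3 : (-e1-e2) ^ 3 + A * (-e1-e2) + B = 0 := by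
      linear_combination (-2 * e1 - e2) * he2 + he1
    have hprod : (e1 + 2 * c) * ((e2 + 2 * c) * ((-e1-e2) + 2 * c)) = -(B - 2 * c ^ 3) := by
      rw [hAdef] at he1 he2
      linear_combination (-e1 - 2 * c) * he2 + he1
    have key : ∀ e : K, e ^ 3 + A * e + B = 0 → ‖e + 2 * c‖ < 1 →
        ∃ e : K, e ^ 3 + A * e + B = 0 ∧ ‖e‖ ≤ 1 ∧ ‖3 * e ^ 2 + A‖ = 1 := by
      intro e he hlt
      have hle := norm_cubic_root_le hA hB he
      refine ⟨e, he, hle, ?_⟩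
      have : 3 * e ^ 2 + A = 3 * 3 * c ^ 2 + 3 * ((e - 2 * c) * (e + 2 * c)) := by rw [hAdef]; ring
      have h1 : ‖3 * 3 * c ^ 2‖ = 1 := by simp [h3, hc]
      rw [this, um_add_eq, h1]
      rw [h1]
      exact um_mul_lt h3.le (um_mul_lt (um_sub hle (um_mul (um_nat 2) hc.le)) hlt)
    by_contra hno
    have k1 : 1 ≤ ‖e1 + 2 * c‖ := by by_contra! h; exact hno (key _ he1 h)
    have k2 : 1 ≤ ‖e2 + 2 * c‖ := by by_contra! h; exact hno (key _ r2 h)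
    have k3 : 1 ≤ ‖(-e1-e2) + 2 * c‖ := by by_contra! h; exact hno (key _ r3 h)
    have := congrArg norm hprod
    rw [norm_neg, norm_mul, norm_mul] at this
    have := one_le_mul_of_one_le_of_one_le k1 (one_le_mul_of_one_le_of_one_le k2 k3)
    linarith
end um

section star
open Finset
variable {K M : Type*} [NormedField K] [IsUltrametricDist K] [IsAlgClosed K]
  [AddCommGroup M] [Fintype M] [DecidableEq M] {A B : K} {X : M → K} {p : ℕ}

theorem XData.norm_eval_sq (hX : XData A B X) (hp : p.Prime) (hp3 : 3 < p)
    (hM : ∀ v : M, p • v = 0) (hcard : Fintype.card M = p ^ 2) (h2 : (2 : K) ≠ 0)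
    (hpK : ‖(p : K)‖ = (p : ℝ)⁻¹) (t : K) :
    ‖((⟨0, 0, 0, A, B⟩ : WeierstrassCurve K).preΨ' p).eval t‖ ^ 2 * (p : ℝ) ^ 2 =
      ∏ v ∈ univ.filter (fun v : M => v ≠ 0), ‖t - X v‖ := by
  classical
  have hp0 : (0 : ℝ) < p := by exact_mod_cast hp.pos
  have hpne : (p : K) ≠ 0 := by
    intro h; rw [h, norm_zero] at hpK
    exact absurd hpK (by positivity)
  have hodd : ¬ Even p := by rw [Nat.not_even_iff_odd]; exact hp.odd_of_ne_two (by omega)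
  set W : WeierstrassCurve K := ⟨0, 0, 0, A, B⟩
  set F := W.preΨ' p with hF
  have hdeg := W.natDegree_preΨ' hpne
  have hlead := W.leadingCoeff_preΨ' hpne
  rw [if_neg hodd] at hdeg hlead
  rw [← hF] at hdeg hlead
  have hF0 : F ≠ 0 := by
    intro h; rw [h, Polynomial.leadingCoeff_zero] at hlead; exact hpne hlead.symm
  set S0 := univ.filter (fun v : M => v ≠ 0) with hS0
  set S := S0.image X with hS
  have hnn : ∀ v : M, v ≠ 0 → v ≠ -v := by
    intro v hv h
    have := nsmul_ne_zero_of_prime hp hv (hM v) (n := 2) (by omega) (by omega)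
    apply this
    rw [two_nsmul]; nth_rewrite 1 [h]; simp
  have hfib : ∀ s ∈ S, #{a ∈ S0 | X a = s} = 2 := by
    intro s hs
    obtain ⟨v, hv, rfl⟩ := mem_image.1 hs
    have hv0 : v ≠ 0 := by simpa [hS0] using hv
    have : ({a ∈ S0 | X a = X v} : Finset M) = {v, -v} := by
      ext w
      simp only [mem_filter, mem_insert, mem_singleton]
      constructor
      · rintro ⟨hw, h⟩
        exact (hX.inj w v (by simpa [hS0] using hw) hv0).1 h
      · intro h
        have hw0 : w ≠ 0 := by
          rcases h with rfl | rfl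
          · exact hv0
          · simpa using hv0
        exact ⟨by simpa [hS0] using hw0, (hX.inj w v hw0 hv0).2 h⟩
    rw [this, card_pair (hnn v hv0)]
  have hS0c : #S0 = p ^ 2 - 1 := by
    rw [hS0, filter_ne', card_erase_of_mem (mem_univ _), card_univ, hcard]
  have hSc : #S * 2 = p ^ 2 - 1 := by
    rw [← hS0c, card_eq_sum_card_image X S0, sum_congr rfl hfib, sum_const, smul_eq_mul]
  have hroots : F.roots = S.val := by
    symm
    refine Multiset.eq_of_le_of_card_le ?_ ?_
    · rw [Finset.val_le_iff_val_subset]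
      intro s hs
      obtain ⟨v, hv, rfl⟩ := mem_image.1 (show s ∈ S from hs)
      have hv0 : v ≠ 0 := by simpa [hS0] using hv
      rw [Polynomial.mem_roots hF0]
      exact hX.preΨ'_root h2 hp hp3 hv0 (hM v)
    · refine (Polynomial.card_roots' F).trans ?_
      rw [hdeg, Finset.card_val]; omega
  have hsplit := Polynomial.C_leadingCoeff_mul_prod_multiset_X_sub_C (p := F) (by
    rw [hroots, hdeg, Finset.card_val]; omega)
  rw [hroots, hlead] at hsplit
  have hev : F.eval t = p * ∏ s ∈ S, (t - s) := by
    rw [← hsplit]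
    rw [Polynomial.eval_mul, Polynomial.eval_C, Polynomial.eval_multiset_prod, Multiset.map_map]
    congr 1
    rw [Finset.prod_eq_multiset_prod]
    congr 1
    exact Multiset.map_congr rfl (by simp)
  rw [prod_comp (fun s => ‖t - s‖) X, ← hS, prod_congr rfl (fun s hs => by rw [hfib s hs]),
    prod_pow, hev, norm_mul, norm_prod, hpK]
  field_simp

theorem XData.star {c : K} (hX : XData A B X) (hp : p.Prime) (hp3 : 3 < p)
    (hM : ∀ v : M, p • v = 0) (hcard : Fintype.card M = p ^ 2) (h2 : ‖(2 : K)‖ = 1) (h3 : ‖(3 : K)‖ = 1)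
    (hpK : ‖(p : K)‖ = (p : ℝ)⁻¹) (hA : ‖A‖ ≤ 1) (hB : ‖B‖ ≤ 1) (hred : RedType A B c) :
    ∏ v ∈ univ.filter (fun v : M => v ≠ 0), max 1 ‖X v‖ = (p : ℝ) ^ 2 := by
  have h20 : (2 : K) ≠ 0 := by intro h; simp [h] at h2
  have E := hX.norm_eval_sq hp hp3 hM hcard h20 hpK
  set W : WeierstrassCurve K := ⟨0, 0, 0, A, B⟩
  have hp0 : (0 : ℝ) < p := by exact_mod_cast hp.pos
  have evF : ∀ t : K, (W.preΨ' p).eval t = preNormEDS' ((4 * (t ^ 3 + A * t + B)) ^ 2)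
      (-(3 * t ^ 2 + A) ^ 2 + 12 * t * (t ^ 3 + A * t + B))
      (2 * t ^ 6 + 10 * A * t ^ 4 + 40 * B * t ^ 3 - 10 * A ^ 2 * t ^ 2
      - 8 * A * B * t - 2 * A ^ 3 - 16 * B ^ 2) p := by
    intro t
    rw [WeierstrassCurve.preΨ', ← Polynomial.coe_evalRingHom, map_preNormEDS']
    congr 1
    · simp [W, WeierstrassCurve.Ψ₂Sq, WeierstrassCurve.b₂, WeierstrassCurve.b₄, WeierstrassCurve.b₆]
      ring
    · simp [W, WeierstrassCurve.Ψ₃, WeierstrassCurve.b₂, WeierstrassCurve.b₄, WeierstrassCurve.b₆, WeierstrassCurve.b₈]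
      ring
    · simp [W, WeierstrassCurve.preΨ₄, WeierstrassCurve.b₂, WeierstrassCurve.b₄, WeierstrassCurve.b₆, WeierstrassCurve.b₈]
      ring
  apply le_antisymm
  · -- upper bound
    set S1 := univ.filter (fun v : M => v ≠ 0 ∧ ‖X v‖ ≤ 1) with hS1
    obtain ⟨t, ht, htp⟩ : ∃ t : K, ‖t‖ ≤ 1 ∧ ∏ v ∈ S1, (t - X v) = 1 := by
      rcases S1.eq_empty_or_nonempty with h | h
      · exact ⟨0, by simp, by simp [h]⟩
      · have hmon : (∏ v ∈ S1, (Polynomial.X - Polynomial.C (X v))).degree = ((#S1 : ℕ) : WithBot ℕ) := by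
          rw [Polynomial.degree_prod]; simp
        have hpos : 0 < #S1 := h.card_pos
        obtain ⟨t, ht⟩ := IsAlgClosed.exists_root (∏ v ∈ S1, (Polynomial.X - Polynomial.C (X v)) - 1) (by
          rw [Polynomial.degree_sub_eq_left_of_degree_lt, hmon]
          · exact_mod_cast hpos.ne'
          · rw [hmon, Polynomial.degree_one]; exact_mod_cast hpos)
        have ht' : ∏ v ∈ S1, (t - X v) = 1 := by
          rw [Polynomial.IsRoot, Polynomial.eval_sub, Polynomial.eval_prod, sub_eq_zero] at ht
          simpa using ht
        refine ⟨t, ?_, ht'⟩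
        by_contra! hlt
        have : ∏ v ∈ S1, ‖t - X v‖ = ‖t‖ ^ #S1 := by
          rw [← prod_const]
          refine prod_congr rfl fun v hv => ?_
          exact um_sub_eq (((mem_filter.1 hv).2.2).trans_lt hlt)
        rw [← norm_prod, ht', norm_one] at this
        have := one_lt_pow₀ hlt hpos.ne'
        linarith
    have hle : ‖(W.preΨ' p).eval t‖ ≤ 1 := by
      rw [evF]
      have hf : ‖t ^ 3 + A * t + B‖ ≤ 1 := um_add (um_add (um_pow ht _) (um_mul hA ht)) hB
      apply norm_preNormEDS'_le
      · exact um_pow (um_mul (um_nat 4) hf) _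
      · refine um_add ?_ (um_mul (um_mul (um_nat 12) ht) hf)
        rw [norm_neg]
        exact um_pow (um_add (um_mul (um_nat 3) (um_pow ht _)) hA) _
      · refine um_sub (um_sub (um_sub (um_sub (um_add (um_add ?_ ?_) ?_) ?_) ?_) ?_) ?_
        · exact um_mul (um_nat 2) (um_pow ht _)
        · exact um_mul (um_mul (um_nat 10) hA) (um_pow ht _)
        · exact um_mul (um_mul (um_nat 40) hB) (um_pow ht _)
        · exact um_mul (um_mul (um_nat 10) (um_pow hA _)) (um_pow ht _)
        · exact um_mul (um_mul (um_mul (um_nat 8) hA) hB) ht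
        · exact um_mul (um_nat 2) (um_pow hA _)
        · exact um_mul (um_nat 16) (um_pow hB _)
    have e1 := E t
    have e2 : ∏ v ∈ univ.filter (fun v : M => v ≠ 0), ‖t - X v‖ =
        ∏ v ∈ univ.filter (fun v : M => v ≠ 0), max 1 ‖X v‖ := by
      rw [← prod_filter_mul_prod_filter_not (univ.filter (fun v : M => v ≠ 0)) (fun v => ‖X v‖ ≤ 1),
        ← prod_filter_mul_prod_filter_not (univ.filter (fun v : M => v ≠ 0)) (fun v => ‖X v‖ ≤ 1) (fun v => max 1 ‖X v‖)]
      congr 1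
      · rw [filter_filter, ← hS1, ← norm_prod, htp, norm_one]
        symm
        exact prod_eq_one fun v hv => max_eq_left (mem_filter.1 hv).2.2
      · refine prod_congr rfl fun v hv => ?_
        have h1 : 1 < ‖X v‖ := not_le.1 (mem_filter.1 hv).2
        rw [max_eq_right h1.le, norm_sub_rev]
        exact um_sub_eq (ht.trans_lt h1)
    rw [← e2, ← e1]
    exact mul_le_of_le_one_left (by positivity) (pow_le_one₀ (norm_nonneg _) hle)
  · obtain ⟨e, he, he1, hd⟩ := exists_good_root hA hB h3 hred
    have hF1 : ‖(W.preΨ' p).eval e‖ = 1 := by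
      rw [evF, he, mul_zero, mul_zero, add_zero, zero_pow (by norm_num)]
      apply norm_preNormEDS'_zero
      · simp [hd]
      · exact hp.odd_of_ne_two (by omega)
    have e1 := E e
    rw [hF1, one_pow, one_mul] at e1
    rw [e1]
    refine prod_le_prod (fun _ _ => norm_nonneg _) fun v _ => ?_
    exact um_sub (he1.trans (le_max_left _ _)) (le_max_right _ _)
end star


section um4
variable {K : Type*} [NormedField K] [IsUltrametricDist K]

theorem um_pair {S T : K} {m L : ℝ} (hm : 0 < m) (hL : m ≤ L) (hprod : ‖S‖ * ‖T‖ = m * L)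
    (hsum : ‖S + T‖ ≤ L) : m ≤ ‖S‖ := by
  by_contra! h
  by_cases hST : ‖S‖ = ‖T‖
  · rw [← hST] at hprod
    nlinarith [norm_nonneg S]
  · have : ‖T‖ ≤ L := by
      rw [IsUltrametricDist.norm_add_eq_max_of_norm_ne_norm hST] at hsum
      exact (le_max_right _ _).trans hsum
    nlinarith [norm_nonneg S, norm_nonneg T]

/-- nonsingularity of the reduction of a point with integral `x`-coordinate `a`. -/
def Ns (A B a : K) : Prop := ‖a ^ 3 + A * a + B‖ = 1 ∨ ‖3 * a ^ 2 + A‖ = 1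

variable {M : Type*} [AddCommGroup M] {A B : K} {X : M → K}

theorem XData.neg (hX : XData A B X) (P : M) : X (-P) = X P := by
  by_cases h : P = 0
  · simp [h]
  · exact (hX.inj (-P) P (by simpa using h) h).2 (Or.inr rfl)

theorem XData.closed_add (hX : XData A B X) (hA : ‖A‖ ≤ 1) (hB : ‖B‖ ≤ 1) (h2 : ‖(2 : K)‖ = 1)
    {R : ℝ} (hR : 1 < R) {P Q : M} (hP : P = 0 ∨ R ≤ ‖X P‖) (hQ : Q = 0 ∨ R ≤ ‖X Q‖) :
    P + Q = 0 ∨ R ≤ ‖X (P + Q)‖ := by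
  have h4 : ‖(4 : K)‖ = 1 := by rw [show (4 : K) = 2 * 2 by norm_num, norm_mul, h2, one_mul]
  rcases eq_or_ne P 0 with rfl | hP0
  · simpa using hQ
  rcases eq_or_ne Q 0 with rfl | hQ0
  · simpa using hP
  replace hP := hP.resolve_left hP0
  replace hQ := hQ.resolve_left hQ0
  by_cases hneg : P = -Q
  · left; rw [hneg]; simp
  right
  by_cases hPQ : P = Q
  · subst hPQ
    have e := congrArg norm (hX.dbl P hP0 hneg)
    set a := X P
    have ha : 1 < ‖a‖ := hR.trans_le hP
    have ha0 : 0 < ‖a‖ := by linarith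
    have f1 : ‖a ^ 3 + A * a + B‖ = ‖a‖ ^ 3 := by
      rw [add_assoc, um_add_eq, norm_pow]
      rw [norm_pow]
      refine (um_add (r := ‖a‖) ?_ (hB.trans ha.le)).trans_lt (lt_self_pow₀ ha (by norm_num))
      rw [norm_mul]; exact mul_le_of_le_one_left (norm_nonneg _) hA
    have f2 : ‖a ^ 2 - A‖ = ‖a‖ ^ 2 := by
      rw [um_sub_eq, norm_pow]
      rw [norm_pow]; exact hA.trans_lt (one_lt_pow₀ ha (by norm_num))
    have f3 : ‖(a ^ 2 - A) ^ 2 - 8 * B * a‖ = ‖a‖ ^ 4 := by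
      rw [um_sub_eq, norm_pow, f2]; ring
      rw [norm_pow, f2, ← pow_mul]
      refine lt_of_le_of_lt (b := ‖a‖) ?_ (lt_self_pow₀ ha (by norm_num))
      rw [norm_mul]; exact mul_le_of_le_one_left (norm_nonneg _) (um_mul (um_nat 8) hB)
    rw [f3, norm_mul, norm_mul, f1, h4, one_mul] at e
    have : ‖X (P + P)‖ = ‖a‖ := by
      have h3 : ‖a‖ ^ 3 ≠ 0 := by positivity
      apply mul_left_cancel₀ h3
      rw [e]; ring
    rw [this]; exact hP
  · have e1 := congrArg norm (hX.sum P Q hP0 hQ0 hPQ hneg)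
    have e2 := congrArg norm (hX.prod P Q hP0 hQ0 hPQ hneg)
    have hne : X P ≠ X Q := fun h => by
      rcases (hX.inj P Q hP0 hQ0).1 h with h | h
      exacts [hPQ h, hneg h]
    set a := X P
    set b := X Q
    have ha : 1 < ‖a‖ := hR.trans_le hP
    have hb : 1 < ‖b‖ := hR.trans_le hQ
    set m := min ‖a‖ ‖b‖ with hm
    set N := max ‖a‖ ‖b‖ with hN
    have hmN : m * N = ‖a‖ * ‖b‖ := min_mul_max _ _
    have hm1 : 1 < m := lt_min ha hb
    have hN1 : 1 < N := lt_max_of_lt_left ha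
    have hD0 : 0 < ‖a - b‖ := norm_pos_iff.2 (sub_ne_zero.2 hne)
    have hDN : ‖a - b‖ ≤ N := um_sub (le_max_left _ _) (le_max_right _ _)
    have hab : ‖a * b‖ = m * N := by rw [norm_mul, hmN]
    have hapb : ‖a + b‖ ≤ N := um_add (le_max_left _ _) (le_max_right _ _)
    have hmN1 : 1 < m * N := by nlinarith
    have f1 : ‖2 * (a * b + A) * (a + b) + 4 * B‖ ≤ m * N ^ 2 := by
      refine um_add ?_ ?_
      · rw [norm_mul, norm_mul, h2, one_mul]
        have : ‖a * b + A‖ ≤ m * N := um_add hab.le (hA.trans hmN1.le)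
        calc _ ≤ (m * N) * N := mul_le_mul this hapb (norm_nonneg _) (by positivity)
          _ = _ := by ring
      · refine (um_mul (um_nat 4) hB).trans ?_
        nlinarith
    have f2 : ‖(a * b - A) ^ 2 - 4 * B * (a + b)‖ = (m * N) ^ 2 := by
      have g : ‖a * b - A‖ = m * N := by
        rw [um_sub_eq, hab]; rw [hab]; exact hA.trans_lt hmN1
      rw [um_sub_eq, norm_pow, g]
      rw [norm_pow, g, norm_mul]
      have : ‖4 * B‖ * ‖a + b‖ ≤ 1 * N := mul_le_mul (um_mul (um_nat 4) hB) hapb (norm_nonneg _) zero_le_one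
      have : N < m * N := by nlinarith
      nlinarith
    rw [norm_mul, norm_pow] at e1
    rw [norm_mul, norm_pow, norm_mul] at e2
    set D := ‖a - b‖
    refine (le_min hP hQ).trans ?_
    refine um_pair (L := m * N ^ 2 / D ^ 2) (T := X (P - Q)) (by linarith) ?_ ?_ ?_
    · rw [le_div_iff₀ (by positivity)]
      have : D ^ 2 ≤ N ^ 2 := pow_le_pow_left₀ hD0.le hDN 2
      nlinarith
    · rw [f2] at e2
      field_simp
      linarith
    · rw [le_div_iff₀ (by positivity)]
      linarith

/-- The subgroup of points with large `x`-coordinate. -/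
def XData.big (hX : XData A B X) (hA : ‖A‖ ≤ 1) (hB : ‖B‖ ≤ 1) (h2 : ‖(2 : K)‖ = 1)
    {R : ℝ} (hR : 1 < R) : AddSubgroup M where
  carrier := {P | P = 0 ∨ R ≤ ‖X P‖}
  zero_mem' := Or.inl rfl
  add_mem' := fun hP hQ => hX.closed_add hA hB h2 hR hP hQ
  neg_mem' := fun {P} hP => by
    rcases hP with h | h
    · left; simp [h]
    · right; rw [hX.neg]; exact h

theorem XData.collision (hX : XData A B X) (hA : ‖A‖ ≤ 1) (hB : ‖B‖ ≤ 1) (h2 : ‖(2 : K)‖ = 1)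
    {P Q : M} (hP0 : P ≠ 0) (hQ0 : Q ≠ 0) (hPQ : P ≠ Q) (hneg : P ≠ -Q)
    (ha : ‖X P‖ ≤ 1) (hb : ‖X Q‖ ≤ 1) (hab : ‖X P - X Q‖ < 1) (hNs : Ns A B (X P)) :
    1 < ‖X (P + Q)‖ ∨ 1 < ‖X (P - Q)‖ := by
  by_contra! hcon
  obtain ⟨hS, hT⟩ := hcon
  have h4 : ‖(4 : K)‖ = 1 := by rw [show (4 : K) = 2 * 2 by norm_num, norm_mul, h2, one_mul]
  have e1 := hX.sum P Q hP0 hQ0 hPQ hneg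
  have e2 := hX.prod P Q hP0 hQ0 hPQ hneg
  set a := X P
  set b := X Q
  have hd : ‖(a - b) ^ 2‖ < 1 := by rw [norm_pow]; exact pow_lt_one₀ (norm_nonneg _) hab (by norm_num)
  have hh : ‖b - a‖ < 1 := by rwa [norm_sub_rev]
  have n1 : ‖2 * (a * b + A) * (a + b) + 4 * B‖ < 1 := by
    rw [← e1]; exact um_mul_lt' hd (um_add hS hT)
  have n2 : ‖(a * b - A) ^ 2 - 4 * B * (a + b)‖ < 1 := by
    rw [← e2]; exact um_mul_lt' hd (um_mul hS hT)
  have hf : ‖a ^ 3 + A * a + B‖ < 1 := by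
    have : 4 * (a ^ 3 + A * a + B) = (2 * (a * b + A) * (a + b) + 4 * B) -
        (b - a) * (2 * (a ^ 2 + A) + 2 * a * (a + b)) := by ring
    have h : ‖4 * (a ^ 3 + A * a + B)‖ < 1 := by
      rw [this]
      exact um_sub_lt n1 (um_mul_lt' hh (um_add (um_mul h2.le (um_add (um_pow ha _) hA))
        (um_mul (um_mul h2.le ha) (um_add ha hb))))
    rwa [norm_mul, h4, one_mul] at h
  rcases hNs with h | h
  · linarith
  · have : (3 * a ^ 2 + A) ^ 2 = ((a * b - A) ^ 2 - 4 * B * (a + b)) + 8 * a * (a ^ 3 + A * a + B) -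
        (b - a) * (a * (a ^ 2 - A) + a * (a * b - A) - 4 * B) := by ring
    have h' : ‖(3 * a ^ 2 + A) ^ 2‖ < 1 := by
      rw [this]
      refine um_sub_lt (um_add_lt n2 (um_mul_lt (um_mul (um_nat 8) ha) hf)) (um_mul_lt' hh ?_)
      exact um_sub (um_add (um_mul ha (um_sub (um_pow ha _) hA)) (um_mul ha (um_sub (um_mul ha hb) hA)))
        (um_mul h4.le hB)
    rw [norm_pow, h] at h'
    norm_num at h'

theorem XData.lemmaM {c δ : K} (hX : XData (-3 * c ^ 2) (2 * c ^ 3 + δ) X) (hc : ‖c‖ = 1) (hδ : ‖δ‖ < 1)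
    (h2 : ‖(2 : K)‖ = 1) (h3 : ‖(3 : K)‖ = 1)
    {P Q : M} (hP0 : P ≠ 0) (hQ0 : Q ≠ 0) (hPQ : P ≠ Q) (hneg : P ≠ -Q)
    (heq : ‖X P - c‖ = ‖X Q - c‖) (hlt : ‖X P - c‖ < 1) :
    1 ≤ ‖X (P + Q) - c‖ ∨ 1 ≤ ‖X (P - Q) - c‖ := by
  by_contra! hcon
  obtain ⟨hS, hT⟩ := hcon
  have h12 : ‖(12 : K)‖ = 1 := by rw [show (12 : K) = 2 * 2 * 3 by norm_num]; simp [h2, h3]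
  have hne : X P ≠ X Q := fun h => by
    rcases (hX.inj P Q hP0 hQ0).1 h with h | h
    exacts [hPQ h, hneg h]
  have e1 := hX.sum P Q hP0 hQ0 hPQ hneg
  have e2 := hX.prod P Q hP0 hQ0 hPQ hneg
  obtain ⟨u, hu⟩ : ∃ u, X P = u + c := ⟨X P - c, by ring⟩
  obtain ⟨w, hw⟩ : ∃ u, X Q = u + c := ⟨X Q - c, by ring⟩
  obtain ⟨s, hs⟩ : ∃ u, X (P + Q) = u + c := ⟨X (P + Q) - c, by ring⟩
  obtain ⟨t, ht⟩ : ∃ u, X (P - Q) = u + c := ⟨X (P - Q) - c, by ring⟩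
  rw [hu, hw, hs, ht] at e1 e2
  rw [hs, add_sub_cancel_right] at hS
  rw [ht, add_sub_cancel_right] at hT
  rw [hu, hw, add_sub_cancel_right, add_sub_cancel_right] at heq
  rw [hu, add_sub_cancel_right] at hlt
  have huw : u ≠ w := by rintro rfl; apply hne; rw [hu, hw]
  have i1 : (u - w) ^ 2 * (s + t) = 12 * c * (u * w) + (2 * (u * w) * (u + w) + 4 * δ) := by
    linear_combination e1
  have i2 : (u - w) ^ 2 * (s * t) = -(12 * c * δ) + ((u * w) ^ 2 - 4 * δ * (u + w)) := by
    linear_combination e2 - c * i1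
  set ρ := ‖u‖ with hρ
  have hρ0 : 0 < ρ := by
    rcases (norm_nonneg u).lt_or_eq with h | h
    · exact h
    · exfalso; apply huw
      rw [← hρ] at h
      have hu0 : u = 0 := norm_eq_zero.1 h.symm
      have hw0 : w = 0 := norm_eq_zero.1 (by rw [← heq, ← h])
      rw [hu0, hw0]
  have hd : ‖(u - w) ^ 2‖ ≤ ρ ^ 2 := by
    rw [norm_pow]; exact pow_le_pow_left₀ (norm_nonneg _) (um_sub hρ.ge heq.ge) 2
  have huw2 : ‖u * w‖ = ρ ^ 2 := by rw [norm_mul, ← heq]; ring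
  have hupw : ‖u + w‖ ≤ ρ := um_add hρ.ge heq.ge
  have hlt1 : ∀ z : K, ‖z‖ < 1 → ‖(u - w) ^ 2 * z‖ < ρ ^ 2 := by
    intro z hz
    rw [norm_mul]
    calc _ ≤ ρ ^ 2 * ‖z‖ := mul_le_mul_of_nonneg_right hd (norm_nonneg _)
      _ < ρ ^ 2 := mul_lt_of_lt_one_right (by positivity) hz
  rcases lt_or_ge ‖δ‖ (ρ ^ 2) with h | h
  · have n1 := hlt1 (s + t) (um_add_lt hS hT)
    have hm : ‖12 * c * (u * w)‖ = ρ ^ 2 := by rw [norm_mul, norm_mul, h12, hc, huw2]; ring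
    rw [i1, um_add_eq, hm] at n1
    · exact lt_irrefl _ n1
    · rw [hm]
      refine um_add_lt ?_ ?_
      · rw [norm_mul, norm_mul, h2, huw2, one_mul]
        exact mul_lt_of_lt_one_right (by positivity) (hupw.trans_lt hlt)
      · rw [norm_mul]; exact (mul_le_of_le_one_left (norm_nonneg _) (um_nat 4)).trans_lt h
  · have n1 := hlt1 (s * t) (um_mul_lt hS.le hT)
    have hδ0 : 0 < ‖δ‖ := lt_of_lt_of_le (by positivity) h
    have hm : ‖-(12 * c * δ)‖ = ‖δ‖ := by rw [norm_neg, norm_mul, norm_mul, h12, hc]; ring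
    rw [i2, um_add_eq, hm] at n1
    · linarith
    · rw [hm]
      refine um_sub_lt ?_ ?_
      · rw [norm_pow, huw2]
        have : ρ ^ 2 < 1 := pow_lt_one₀ hρ0.le hlt (by norm_num)
        have : 0 < ρ ^ 2 := by positivity
        nlinarith
      · rw [norm_mul, norm_mul]
        have h4 := um_nat (K := K) 4
        have hl : ‖u + w‖ < 1 := hupw.trans_lt hlt
        calc ‖(4 : K)‖ * ‖δ‖ * ‖u + w‖ ≤ 1 * ‖δ‖ * ‖u + w‖ := by gcongr
          _ < ‖δ‖ := by rw [one_mul]; exact mul_lt_of_lt_one_right hδ0 hl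

theorem ns_of_good {a : K} (hA : ‖A‖ ≤ 1) (hB : ‖B‖ ≤ 1) (ha : ‖a‖ ≤ 1)
    (hg : ‖4 * A ^ 3 + 27 * B ^ 2‖ = 1) : Ns A B a := by
  by_contra h
  unfold Ns at h
  push Not at h
  have hf1 : ‖a ^ 3 + A * a + B‖ ≤ 1 := um_add (um_add (um_pow ha _) (um_mul hA ha)) hB
  have hf2 : ‖3 * a ^ 2 + A‖ ≤ 1 := um_add (um_mul (um_nat 3) (um_pow ha _)) hA
  have h1 := lt_of_le_of_ne hf1 h.1
  have h2 := lt_of_le_of_ne hf2 h.2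
  have : 4 * A ^ 3 + 27 * B ^ 2 = (a ^ 3 + A * a + B) * (27 * (a ^ 3 + A * a + B) - 54 * a * (a ^ 2 + A)) +
      (3 * a ^ 2 + A) * ((3 * a ^ 2 + A) * (4 * A + 3 * a ^ 2)) := by ring
  rw [this] at hg
  refine absurd hg (ne_of_lt (um_add_lt (um_mul_lt' h1 ?_) (um_mul_lt' h2 ?_)))
  · exact um_sub (um_mul (um_nat 27) hf1) (um_mul (um_mul (um_nat 54) ha) (um_add (um_pow ha _) hA))
  · exact um_mul hf2 (um_add (um_mul (um_nat 4) hA) (um_mul (um_nat 3) (um_pow ha _)))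

theorem near_c_of_not_ns {a c δ : K} (hc : ‖c‖ = 1) (hδ : ‖δ‖ < 1) (h2 : ‖(2 : K)‖ = 1)
    (h3 : ‖(3 : K)‖ = 1) (ha : ‖a‖ ≤ 1) (h : ¬ Ns (-3 * c ^ 2) (2 * c ^ 3 + δ) a) : ‖a - c‖ < 1 := by
  unfold Ns at h
  push Not at h
  have hu : ‖a - c‖ ≤ 1 := um_sub ha hc.le
  have hv : ‖a + c‖ ≤ 1 := um_add ha hc.le
  by_contra! hge
  have hu1 := le_antisymm hu hge
  have e2 : 3 * a ^ 2 + -3 * c ^ 2 = 3 * ((a - c) * (a + c)) := by ring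
  rw [e2, norm_mul, norm_mul, h3, hu1, one_mul, one_mul] at h
  have hv1 := lt_of_le_of_ne hv h.2
  apply h.1
  have e1 : a ^ 3 + -3 * c ^ 2 * a + (2 * c ^ 3 + δ) = (a - c) ^ 2 * (c + (a + c)) + δ := by ring
  have g : ‖(a - c) ^ 2 * (c + (a + c))‖ = 1 := by
    rw [norm_mul, norm_pow, hu1, um_add_eq, hc]; norm_num
    rw [hc]; exact hv1
  rw [e1, um_add_eq, g]
  rw [g]; exact hδ
end um4


section grp
variable {p : ℕ} [Fact p.Prime]

theorem nsEps_nonsq (hp : 2 < p) : ¬ ∃ x : ZMod p, x ^ 2 = nsEps p := by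
  have hne : ({n : ℕ | 0 < n ∧ ¬∃ x : ZMod p, x ^ 2 = (n : ZMod p)}).Nonempty := by
    have hc : ringChar (ZMod p) ≠ 2 := by rw [ZMod.ringChar_zmod_n]; omega
    obtain ⟨a, ha⟩ := FiniteField.exists_nonsquare hc
    refine ⟨a.val, ?_, ?_⟩
    · rcases Nat.eq_zero_or_pos a.val with h | h
      · exfalso; apply ha
        rw [ZMod.val_eq_zero] at h
        exact ⟨0, by simp [h]⟩
      · exact h
    · rintro ⟨x, hx⟩
      apply ha
      refine ⟨x, ?_⟩
      rw [ZMod.natCast_zmod_val] at hx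
      rw [← hx, sq]
  exact (Nat.sInf_mem hne).2

theorem cns_form_eq_zero (hp : 2 < p) {a b : ZMod p} (h : a ^ 2 - nsEps p * b ^ 2 = 0) :
    a = 0 ∧ b = 0 := by
  have hb : b = 0 := by
    by_contra hb
    apply nsEps_nonsq hp
    refine ⟨a / b, ?_⟩
    field_simp
    linear_combination h
  subst hb
  simp at h
  exact ⟨h, rfl⟩

def IsScal (M : Matrix (Fin 2) (Fin 2) (ZMod p)) : Prop := ∃ l : ZMod p, M = l • (1 : Matrix (Fin 2) (Fin 2) (ZMod p))

theorem cns_eigen (hp : 2 < p) {a b l : ZMod p} {w : Fin 2 → ZMod p} (hw : w ≠ 0)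
    (h : Matrix.mulVec !![a, nsEps p * b; b, a] w = l • w) :
    IsScal (!![a, nsEps p * b; b, a]) := by
  have h0 := congrFun h 0
  have h1 := congrFun h 1
  simp [Matrix.mulVec, dotProduct, Fin.sum_univ_two] at h0 h1
  have hb : b = 0 := by
    by_contra hb
    have : b * (w 0 ^ 2 - nsEps p * w 1 ^ 2) = 0 := by
      linear_combination w 0 * h1 - w 1 * h0
    rcases mul_eq_zero.1 this with h | h
    · exact hb h
    · obtain ⟨e1, e2⟩ := cns_form_eq_zero hp h
      apply hw
      ext i; fin_cases i <;> simp [e1, e2]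
  subst hb
  refine ⟨a, ?_⟩
  ext i j; fin_cases i <;> fin_cases j <;> simp

theorem cns_cube (a b : ZMod p) (e : ZMod p) : ∃ c d : ZMod p,
    (!![a, e * b; b, a] : Matrix (Fin 2) (Fin 2) (ZMod p)) ^ 3 = !![c, e * d; d, c] := by
  refine ⟨a^3 + 3 * e * a * b^2, 3 * a^2 * b + e * b^3, ?_⟩
  rw [pow_succ, pow_two]
  ext i j; fin_cases i <;> fin_cases j <;> simp [Matrix.mul_apply, Fin.sum_univ_two] <;> ring

theorem gset_types {M : GL (Fin 2) (ZMod p)} (hM : M ∈ Gset p) :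
    (∃ a b : ZMod p, (M : Matrix (Fin 2) (Fin 2) (ZMod p)) = !![a, nsEps p * b; b, a]) ∨
    (∃ a b : ZMod p, (M : Matrix (Fin 2) (Fin 2) (ZMod p)) = !![a, nsEps p * b; -b, -a]) := by
  rcases hM with ⟨a, ⟨x, y, hxy⟩, rfl⟩ | ⟨a, ⟨x, y, hxy⟩, h⟩
  · left
    obtain ⟨c, d, h⟩ := cns_cube x y (nsEps p)
    exact ⟨c, d, by rw [Units.val_pow_eq_pow_val, hxy, h]⟩
  · right
    obtain ⟨c, d, h'⟩ := cns_cube x y (nsEps p)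
    refine ⟨c, d, ?_⟩
    rw [h, hxy, h']
    ext i j; fin_cases i <;> fin_cases j <;> simp [Matrix.mul_apply, Fin.sum_univ_two]

theorem gset_eigen (hp : 2 < p) {M1 M2 : GL (Fin 2) (ZMod p)} (h1 : M1 ∈ Gset p) (h2 : M2 ∈ Gset p)
    {w : Fin 2 → ZMod p} (hw : w ≠ 0) {l1 l2 : ZMod p} (e1 : Matrix.mulVec M1.1 w = l1 • w)
    (e2 : Matrix.mulVec M2.1 w = l2 • w) : IsScal M1.1 ∨ IsScal M2.1 ∨ IsScal (M1.1 * M2.1) := by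
  rcases gset_types h1 with ⟨a, b, h⟩ | ⟨a, b, h⟩
  · left; rw [h] at e1 ⊢; exact cns_eigen hp hw e1
  rcases gset_types h2 with ⟨c, d, h'⟩ | ⟨c, d, h'⟩
  · right; left; rw [h'] at e2 ⊢; exact cns_eigen hp hw e2
  right; right
  have key : M1.1 * M2.1 = !![a*c - nsEps p * b * d, nsEps p * (a*d - b*c); a*d-b*c, a*c - nsEps p * b * d] := by
    rw [h, h']
    ext i j; fin_cases i <;> fin_cases j <;> simp [Matrix.mul_apply, Fin.sum_univ_two] <;> ring
  have e3 : Matrix.mulVec (M1.1 * M2.1) w = (l2 * l1) • w := by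
    rw [← Matrix.mulVec_mulVec, e2, Matrix.mulVec_smul, e1, smul_smul]
  rw [key] at e3 ⊢
  exact cns_eigen hp hw e3

theorem conj_eigen (hp : 2 < p) {g M1 M2 : GL (Fin 2) (ZMod p)}
    (h1 : M1 ∈ (fun x => g * x * g⁻¹) '' Gset p) (h2 : M2 ∈ (fun x => g * x * g⁻¹) '' Gset p)
    {w : Fin 2 → ZMod p} (hw : w ≠ 0) {l1 l2 : ZMod p} (e1 : Matrix.mulVec M1.1 w = l1 • w)
    (e2 : Matrix.mulVec M2.1 w = l2 • w) : IsScal M1.1 ∨ IsScal M2.1 ∨ IsScal (M1.1 * M2.1) := by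
  obtain ⟨x1, hx1, rfl⟩ := h1
  obtain ⟨x2, hx2, rfl⟩ := h2
  have hgi : (g⁻¹ : GL (Fin 2) (ZMod p)).1 * g.1 = 1 := by
    rw [← Units.val_mul]; simp
  have hgi' : g.1 * (g⁻¹ : GL (Fin 2) (ZMod p)).1 = 1 := by
    rw [← Units.val_mul]; simp
  set w' := Matrix.mulVec (g⁻¹ : GL (Fin 2) (ZMod p)).1 w with hw'
  have hgw : Matrix.mulVec g.1 w' = w := by
    rw [hw', Matrix.mulVec_mulVec, hgi', Matrix.one_mulVec]
  have hw0 : w' ≠ 0 := by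
    intro h; rw [h, Matrix.mulVec_zero] at hgw; exact hw hgw.symm
  have tr : ∀ (x : GL (Fin 2) (ZMod p)) (l : ZMod p), Matrix.mulVec (g * x * g⁻¹ : GL (Fin 2) (ZMod p)).1 w = l • w →
      Matrix.mulVec x.1 w' = l • w' := by
    intro x l h
    have : Matrix.mulVec (g⁻¹ : GL (Fin 2) (ZMod p)).1 (Matrix.mulVec (g * x * g⁻¹ : GL (Fin 2) (ZMod p)).1 w) = l • w' := by
      rw [h, Matrix.mulVec_smul]
    rw [← this, Matrix.mulVec_mulVec, ← Units.val_mul, Matrix.mulVec_mulVec, ← Units.val_mul]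
    congr 2; group
  have sc : ∀ (y : Matrix (Fin 2) (Fin 2) (ZMod p)), IsScal y → IsScal (g.1 * y * (g⁻¹ : GL (Fin 2) (ZMod p)).1) := by
    rintro y ⟨l, rfl⟩
    exact ⟨l, by rw [Matrix.mul_smul, Matrix.smul_mul, Matrix.mul_one, hgi']⟩
  rcases gset_eigen hp hx1 hx2 hw0 (tr _ _ e1) (tr _ _ e2) with h | h | h
  · left; exact sc _ h
  · right; left; exact sc _ h
  · right; right
    convert sc _ h using 1
    simp only [Units.val_mul]
    calc _ = g.1 * x1.1 * ((g⁻¹ : GL (Fin 2) (ZMod p)).1 * g.1) * x2.1 * (g⁻¹ : GL (Fin 2) (ZMod p)).1 := by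
            simp only [Matrix.mul_assoc]
      _ = _ := by rw [hgi]; simp only [Matrix.mul_assoc, Matrix.mul_one, Matrix.one_mul]

def CnsSub (p : ℕ) [Fact p.Prime] : Subgroup (GL (Fin 2) (ZMod p)) where
  carrier := Cns p
  one_mem' := ⟨1, 0, by ext i j; fin_cases i <;> fin_cases j <;> simp⟩
  mul_mem' := by
    rintro x y ⟨a, b, h⟩ ⟨c, d, h'⟩
    refine ⟨a * c + nsEps p * b * d, a * d + b * c, ?_⟩
    rw [Units.val_mul, h, h']
    ext i j; fin_cases i <;> fin_cases j <;> simp [Matrix.mul_apply, Fin.sum_univ_two] <;> ring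
  inv_mem' := by
    rintro x ⟨a, b, h⟩
    refine ⟨Ring.inverse (x.1.det) * a, - (Ring.inverse (x.1.det) * b), ?_⟩
    rw [Matrix.coe_units_inv, Matrix.inv_def, Matrix.adjugate_fin_two, h]
    ext i j; fin_cases i <;> fin_cases j <;> simp <;> ring

theorem cns_comm (x y : GL (Fin 2) (ZMod p)) (hx : x ∈ Cns p) (hy : y ∈ Cns p) : x * y = y * x := by
  obtain ⟨a, b, h⟩ := hx
  obtain ⟨c, d, h'⟩ := hy
  apply Units.ext
  rw [Units.val_mul, Units.val_mul, h, h']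
  ext i j; fin_cases i <;> fin_cases j <;> simp [Matrix.mul_apply, Fin.sum_univ_two] <;> ring

def cubeHom (p : ℕ) [Fact p.Prime] : CnsSub p →* CnsSub p where
  toFun x := x ^ 3
  map_one' := one_pow _
  map_mul' x y := (show Commute x y from Subtype.ext (cns_comm _ _ x.2 y.2)).mul_pow 3

theorem card_cns (hp : 2 < p) : Nat.card (CnsSub p) = p ^ 2 - 1 := by
  have h1 : Nat.card (CnsSub p) = Nat.card {v : ZMod p × ZMod p // v ≠ 0} := by
    have hne : ∀ x : CnsSub p, ((x.1.1 0 0, x.1.1 1 0) : ZMod p × ZMod p) ≠ 0 := by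
      rintro ⟨x, a, b, h⟩ h0
      simp [h] at h0
      have hd : IsUnit x.1.det := (Matrix.isUnit_iff_isUnit_det _).1 x.isUnit
      rw [h, h0.1, h0.2] at hd
      simp at hd
    refine Nat.card_eq_of_bijective (fun x => ⟨(x.1.1 0 0, x.1.1 1 0), hne x⟩) ⟨?_, ?_⟩
    · rintro ⟨x, a, b, h⟩ ⟨y, c, d, h'⟩ hxy
      simp [h, h'] at hxy
      apply Subtype.ext; apply Units.ext
      simp only
      rw [h, h', hxy.1, hxy.2]
    · rintro ⟨⟨a, b⟩, hab⟩
      have hd : (!![a, nsEps p * b; b, a] : Matrix (Fin 2) (Fin 2) (ZMod p)).det ≠ 0 := by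
        intro h
        rw [Matrix.det_fin_two_of] at h
        obtain ⟨r1, r2⟩ := cns_form_eq_zero hp (a := a) (b := b) (by linear_combination h)
        exact hab (by rw [r1, r2]; rfl)
      refine ⟨⟨Matrix.GeneralLinearGroup.mkOfDetNeZero _ hd, a, b, rfl⟩, ?_⟩
      apply Subtype.ext
      simp [Matrix.GeneralLinearGroup.mkOfDetNeZero]
  rw [h1, Nat.card_eq_fintype_card, Fintype.card_subtype_compl]
  simp [ZMod.card, sq]

theorem card_gset (hp : 3 < p) : ∃ c k : ℕ, Nat.card (Gset p) = 2 * c ∧ c * k = p ^ 2 - 1 ∧ 3 ∣ k ∧ 0 < c := by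
  have hpp : p.Prime := Fact.out
  have hcard := card_cns (p := p) (by omega)
  have hfin : Finite (CnsSub p) := inferInstance
  refine ⟨Nat.card (cubeHom p).range, Nat.card (cubeHom p).ker, ?_, ?_, ?_, Nat.card_pos⟩
  · have hS1 : Nat.card (cubeHom p).range = Set.ncard {M : GL (Fin 2) (ZMod p) | ∃ a ∈ Cns p, M = a ^ 3} := by
      rw [show Nat.card (cubeHom p).range = Set.ncard ((cubeHom p).range : Set (CnsSub p)) from rfl, ← Set.ncard_image_of_injective _ (Subtype.val_injective : Function.Injective (Subtype.val : CnsSub p → _))]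
      congr 1
      ext M
      constructor
      · rintro ⟨y, ⟨x, rfl⟩, rfl⟩
        exact ⟨x.1, x.2, rfl⟩
      · rintro ⟨a, ha, rfl⟩
        exact ⟨_, ⟨⟨a, ha⟩, rfl⟩, rfl⟩
    have hJd : (!![1, 0; 0, -1] : Matrix (Fin 2) (Fin 2) (ZMod p)).det ≠ 0 := by
      rw [Matrix.det_fin_two_of]; simp
    set J : GL (Fin 2) (ZMod p) := Matrix.GeneralLinearGroup.mkOfDetNeZero _ hJd with hJ
    have hG : Gset p = {M : GL (Fin 2) (ZMod p) | ∃ a ∈ Cns p, M = a ^ 3} ∪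
        (fun x => J * x) '' {M : GL (Fin 2) (ZMod p) | ∃ a ∈ Cns p, M = a ^ 3} := by
      ext M
      constructor
      · rintro (h | ⟨a, ha, h⟩)
        · left; exact h
        · right
          refine ⟨a ^ 3, ⟨a, ha, rfl⟩, ?_⟩
          apply Units.ext
          simp only [Units.val_mul, Units.val_pow_eq_pow_val]
          rw [h]; rfl
      · rintro (h | ⟨_, ⟨a, ha, rfl⟩, h⟩)
        · left; exact h
        · right
          refine ⟨a, ha, ?_⟩
          rw [← h]
          simp only [Units.val_mul, Units.val_pow_eq_pow_val]
          rfl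
    have hdis : Disjoint {M : GL (Fin 2) (ZMod p) | ∃ a ∈ Cns p, M = a ^ 3}
        ((fun x => J * x) '' {M : GL (Fin 2) (ZMod p) | ∃ a ∈ Cns p, M = a ^ 3}) := by
      rw [Set.disjoint_left]
      rintro M ⟨a, ⟨x, y, ha⟩, rfl⟩ ⟨_, ⟨b, ⟨z, w, hb⟩, rfl⟩, h⟩
      have h' := congrArg Units.val h
      simp only [Units.val_mul, Units.val_pow_eq_pow_val] at h'
      obtain ⟨c, d, e1⟩ := cns_cube x y (nsEps p)
      obtain ⟨c', d', e2⟩ := cns_cube z w (nsEps p)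
      rw [ha, hb, e1, e2, show J.1 = !![1, 0; 0, -1] from rfl] at h'
      have q1 := congrFun (congrFun h' 0) 0
      have q2 := congrFun (congrFun h' 1) 0
      have q3 := congrFun (congrFun h' 1) 1
      have q4 := congrFun (congrFun h' 0) 1
      simp [Matrix.mul_apply, Fin.sum_univ_two] at q1 q2 q3 q4
      have h2 : (2 : ZMod p) ≠ 0 := by
        intro h
        have : ((2 : ℕ) : ZMod p) = 0 := by exact_mod_cast h
        rw [ZMod.natCast_eq_zero_iff] at this
        exact absurd (Nat.le_of_dvd (by norm_num) this) (by omega)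
      have hε : nsEps p ≠ 0 := fun h => nsEps_nonsq (p := p) (by omega) ⟨0, by rw [h]; ring⟩
      have hc : c = 0 := by
        have : 2 * c = 0 := by linear_combination - q1 - q3
        exact (mul_eq_zero.1 this).resolve_left h2
      have hd : d = 0 := by
        have q5 : d' = d := by
          rcases q4 with h | h
          · exact h
          · exact absurd h hε
        have : 2 * d = 0 := by linear_combination -q2 - q5
        exact (mul_eq_zero.1 this).resolve_left h2
      have hu : IsUnit (a.1 ^ 3).det := (Matrix.isUnit_iff_isUnit_det _).1 (a.isUnit.pow 3)
      rw [ha, e1, hc, hd] at hu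
      simp at hu
    rw [show Nat.card (Gset p) = (Gset p).ncard from rfl, hG, Set.ncard_union_eq hdis (Set.toFinite _) (Set.toFinite _),
      Set.ncard_image_of_injective _ (mul_right_injective J), hS1]
    ring
  · rw [← hcard, ← (cubeHom p).ker.card_mul_index, Subgroup.index_ker]
    ring
  · have h3 : 3 ∣ Nat.card (CnsSub p) := by
      rw [hcard]
      have : ¬ 3 ∣ p := fun h => by
        have := (Nat.prime_dvd_prime_iff_eq Nat.prime_three hpp).1 h; omega
      have hm : p % 3 = 1 ∨ p % 3 = 2 := by omega
      have : p ^ 2 % 3 = 1 := by rcases hm with h | h <;> simp [Nat.pow_mod, h]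
      omega
    haveI : Fact (Nat.Prime 3) := ⟨Nat.prime_three⟩
    obtain ⟨x, hx⟩ := exists_prime_orderOf_dvd_card' (G := CnsSub p) 3 h3
    have hk : x ∈ (cubeHom p).ker := by
      rw [MonoidHom.mem_ker]
      show x ^ 3 = 1
      rw [← hx]; exact pow_orderOf_eq_one x
    have := orderOf_dvd_natCard (⟨x, hk⟩ : (cubeHom p).ker)
    rwa [Subgroup.orderOf_mk, hx] at this
end grp


section vec
variable {p : ℕ} [Fact p.Prime]

theorem zsmul_val (l : ZMod p) (v : Fin 2 → ZMod p) : l • v = l.val • v := by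
  rw [← Nat.cast_smul_eq_nsmul (ZMod p), ZMod.natCast_zmod_val]

theorem span2 {v w : Fin 2 → ZMod p} (hv : v ≠ 0) (hw : ∀ l : ZMod p, w ≠ l • v) (u : Fin 2 → ZMod p) :
    ∃ a b : ZMod p, u = a • v + b • w := by
  by_cases hD : v 0 * w 1 - v 1 * w 0 = 0
  · exfalso
    by_cases h0 : v 0 = 0
    · have h1 : v 1 ≠ 0 := by
        intro h1; apply hv; ext i; fin_cases i <;> simp [h0, h1]
      apply hw (w 1 / v 1)
      have hw0 : w 0 = 0 := by
        have : v 1 * w 0 = 0 := by rw [h0] at hD; linear_combination -hD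
        exact (mul_eq_zero.1 this).resolve_left h1
      ext i; fin_cases i
      · simp [hw0, h0]
      · simp; field_simp
    · apply hw (w 0 / v 0)
      ext i; fin_cases i
      · simp; field_simp
      · simp; field_simp; linear_combination hD
  · refine ⟨(u 0 * w 1 - u 1 * w 0) / (v 0 * w 1 - v 1 * w 0),
      (v 0 * u 1 - v 1 * u 0) / (v 0 * w 1 - v 1 * w 0), ?_⟩
    have key : ∀ D a b x : ZMod p, D ≠ 0 → a + b = D * x → x = a / D + b / D := by
      intro D a b x hD h
      rw [← add_div, h, mul_div_cancel_left₀ _ hD]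
    ext i; fin_cases i
    · simp only [Pi.add_apply, Pi.smul_apply, smul_eq_mul, div_mul_eq_mul_div]
      apply key _ _ _ _ hD; simp; ring
    · simp only [Pi.add_apply, Pi.smul_apply, smul_eq_mul, div_mul_eq_mul_div]
      apply key _ _ _ _ hD; simp; ring

theorem isScal_mulVec {M : Matrix (Fin 2) (Fin 2) (ZMod p)} {l : ZMod p} (h : M = l • (1 : Matrix (Fin 2) (Fin 2) (ZMod p)))
    (v : Fin 2 → ZMod p) : Matrix.mulVec M v = l • v := by
  rw [h, Matrix.smul_mulVec, Matrix.one_mulVec]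

theorem isScal_inv {M : GL (Fin 2) (ZMod p)} (h : IsScal (M⁻¹ : GL (Fin 2) (ZMod p)).1) : IsScal M.1 := by
  obtain ⟨l, hl⟩ := h
  have h1 : (M⁻¹ : GL (Fin 2) (ZMod p)).1 * M.1 = 1 := by rw [← Units.val_mul]; simp
  rw [hl, Matrix.smul_mul, Matrix.one_mul] at h1
  have hl0 : l ≠ 0 := by
    rintro rfl
    rw [zero_smul] at h1
    exact zero_ne_one h1
  exact ⟨l⁻¹, by rw [← h1, smul_smul, inv_mul_cancel₀ hl0, one_smul]⟩

theorem isScal_mul {M N : Matrix (Fin 2) (Fin 2) (ZMod p)} (h : IsScal M) (h' : IsScal N) : IsScal (M * N) := by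
  obtain ⟨l, rfl⟩ := h
  obtain ⟨m, rfl⟩ := h'
  exact ⟨l * m, by rw [Matrix.smul_mul, Matrix.one_mul, smul_smul]⟩

theorem isScal_conj (g : GL (Fin 2) (ZMod p)) {M : GL (Fin 2) (ZMod p)} (h : IsScal M.1) :
    IsScal (g⁻¹ * M * g : GL (Fin 2) (ZMod p)).1 := by
  obtain ⟨l, hl⟩ := h
  refine ⟨l, ?_⟩
  have h1 : (g⁻¹ : GL (Fin 2) (ZMod p)).1 * g.1 = 1 := by rw [← Units.val_mul]; simp
  rw [Units.val_mul, Units.val_mul, hl, Matrix.mul_smul, Matrix.smul_mul, Matrix.mul_one, h1]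

theorem scal_ne_zero {M : GL (Fin 2) (ZMod p)} {l : ZMod p} (h : M.1 = l • (1 : Matrix (Fin 2) (Fin 2) (ZMod p))) : l ≠ 0 := by
  rintro rfl
  rw [zero_smul] at h
  exact M.isUnit.ne_zero h
end vec

/-- The local data on which the main argument operates. -/
structure Core (p : ℕ) [Fact p.Prime] {K Γ : Type*} [NormedField K] [IsUltrametricDist K] [IsAlgClosed K]
    [Group Γ] (act : Γ →* (K ≃+* K)) (r : Γ →* GL (Fin 2) (ZMod p)) (g : GL (Fin 2) (ZMod p))
    (A B c : K) (X : (Fin 2 → ZMod p) → K) : Prop where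
  hp : 37 < p
  hX : XData A B X
  h2 : ‖(2 : K)‖ = 1
  h3 : ‖(3 : K)‖ = 1
  hpK : ‖(p : K)‖ = (p : ℝ)⁻¹
  hA : ‖A‖ ≤ 1
  hB : ‖B‖ ≤ 1
  hred : RedType A B c
  iso : ∀ τ z, ‖act τ z‖ = ‖z‖
  fix : ∀ z, z ≠ 0 → (∀ τ, act τ z = z) → ∃ k : ℤ, ‖z‖ ^ 4 = (p : ℝ) ^ k
  img : ∀ τ, r τ ∈ (fun x => g * x * g⁻¹) '' Gset p
  actc : ∀ τ, act τ c = c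
  eqv : ∀ τ v, v ≠ 0 → act τ (X v) = X (Matrix.mulVec (r τ).1 v)
  ss : ∀ R : ℝ, 1 < R → (∀ w, w ≠ 0 → ‖X w‖ = R) → ∃ k : ℤ, R ^ (2 * Nat.card (Gset p)) = (p : ℝ) ^ k

section core
open Finset
variable {p : ℕ} [Fact p.Prime] {K Γ : Type*} [NormedField K] [IsUltrametricDist K] [IsAlgClosed K]
    [Group Γ] {act : Γ →* (K ≃+* K)} {r : Γ →* GL (Fin 2) (ZMod p)} {g : GL (Fin 2) (ZMod p)}
    {A B c : K} {X : (Fin 2 → ZMod p) → K}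

theorem Core.index2 (h : Core p act r g A B c X) {w : Fin 2 → ZMod p} (hw : w ≠ 0)
    (hev : ∀ τ, ∃ l : ZMod p, Matrix.mulVec (r τ).1 w = l • w) {z : K} (hz : z ≠ 0)
    (hfix : ∀ τ, IsScal (r τ).1 → act τ z = z) : ∃ k : ℤ, ‖z‖ ^ 8 = (p : ℝ) ^ k := by
  have hp := h.hp
  by_cases hall : ∀ τ, act τ z = z
  · obtain ⟨k, hk⟩ := h.fix z hz hall
    refine ⟨k * 2, ?_⟩
    rw [show (8 : ℕ) = 4 * 2 by norm_num, pow_mul, hk, _root_.zpow_mul]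
    norm_cast
  push Not at hall
  obtain ⟨a, ha⟩ := hall
  have hna : ¬ IsScal (r a).1 := fun hs => ha (hfix a hs)
  have hmul : ∀ σ τ : Γ, ∀ x, act (σ * τ) x = act σ (act τ x) := fun σ τ x => by
    rw [map_mul]; rfl
  have hu : ∀ τ, act τ (z * act a z) = z * act a z := by
    intro τ
    rw [map_mul]
    by_cases hs : IsScal (r τ).1
    · rw [hfix τ hs]
      congr 1
      have h1 : act (a⁻¹ * τ * a) z = z := hfix _ (by
        rw [map_mul, map_mul, map_inv]; exact isScal_conj _ hs)
      calc act τ (act a z) = act (τ * a) z := (hmul _ _ _).symm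
        _ = act (a * (a⁻¹ * τ * a)) z := by congr 2; group
        _ = act a z := by rw [hmul, h1]
    · have e1 : act τ (act a z) = z := by
        rw [← hmul]
        apply hfix
        obtain ⟨l1, h1⟩ := hev τ
        obtain ⟨l2, h2⟩ := hev a
        rw [map_mul]
        exact ((conj_eigen (by omega) (h.img τ) (h.img a) hw h1 h2).resolve_left hs).resolve_left hna
      have e2 : act τ z = act a z := by
        have : act (a⁻¹ * τ) z = z := by
          apply hfix
          obtain ⟨l1, h1⟩ := hev a⁻¹
          obtain ⟨l2, h2⟩ := hev τ
          have := conj_eigen (by omega) (h.img a⁻¹) (h.img τ) hw h1 h2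
          rw [map_inv] at this
          have := (this.resolve_left (fun hh => hna (isScal_inv hh))).resolve_left hs
          rw [map_mul, map_inv]; exact this
        calc act τ z = act (a * (a⁻¹ * τ)) z := by congr 2; group
          _ = act a z := by rw [hmul, this]
      rw [e1, e2, mul_comm]
  have hz' : z * act a z ≠ 0 := mul_ne_zero hz (by simpa using hz)
  obtain ⟨k, hk⟩ := h.fix _ hz' hu
  refine ⟨k, ?_⟩
  rw [norm_mul, h.iso] at hk
  rw [← hk]; ring

/-- the scalars occurring in the image of `r` -/
noncomputable def Lam (r : Γ →* GL (Fin 2) (ZMod p)) : Finset (ZMod p) := by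
  classical
  exact univ.filter (fun l => ∃ τ, (r τ).1 = l • (1 : Matrix (Fin 2) (Fin 2) (ZMod p)))

theorem mem_Lam {r : Γ →* GL (Fin 2) (ZMod p)} {l : ZMod p} :
    l ∈ Lam r ↔ ∃ τ, (r τ).1 = l • (1 : Matrix (Fin 2) (Fin 2) (ZMod p)) := by
  simp [Lam]

theorem one_mem_Lam : (1 : ZMod p) ∈ Lam r := mem_Lam.2 ⟨1, by simp⟩

theorem Lam_ne_zero {l : ZMod p} (h : l ∈ Lam r) : l ≠ 0 := by
  obtain ⟨τ, hτ⟩ := mem_Lam.1 h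
  exact scal_ne_zero hτ

theorem Lam_bij {l0 : ZMod p} (h0 : l0 ∈ Lam r) : Set.BijOn (fun l => l0 * l) (Lam r) (Lam r) := by
  have hm : Set.MapsTo (fun l => l0 * l) (Lam r : Set (ZMod p)) (Lam r) := by
    intro l hl
    obtain ⟨τ, hτ⟩ := mem_Lam.1 h0
    obtain ⟨σ, hσ⟩ := mem_Lam.1 hl
    refine mem_Lam.2 ⟨τ * σ, ?_⟩
    rw [map_mul, Units.val_mul, hτ, hσ, Matrix.smul_mul, Matrix.one_mul, smul_smul]
  have hi : Set.InjOn (fun l => l0 * l) (Lam r : Set (ZMod p)) :=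
    fun x _ y _ hxy => mul_left_cancel₀ (Lam_ne_zero h0) hxy
  exact ⟨hm, hi, Finset.surjOn_of_injOn_of_card_le _ hm hi le_rfl⟩

theorem Lam_sum_fix {F : ZMod p → K} {τ : Γ} {l0 : ZMod p} (hτ : (r τ).1 = l0 • (1 : Matrix (Fin 2) (Fin 2) (ZMod p)))
    (hF : ∀ l ∈ Lam r, act τ (F l) = F (l0 * l)) : act τ (∑ l ∈ Lam r, F l) = ∑ l ∈ Lam r, F l := by
  obtain ⟨h1, h2, h3⟩ := Lam_bij (r := r) (mem_Lam.2 ⟨τ, hτ⟩)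
  rw [map_sum]
  exact Finset.sum_nbij (fun l => l0 * l) h1 h2 h3 hF

theorem Lam_prod_fix {F : ZMod p → K} {τ : Γ} {l0 : ZMod p} (hτ : (r τ).1 = l0 • (1 : Matrix (Fin 2) (Fin 2) (ZMod p)))
    (hF : ∀ l ∈ Lam r, act τ (F l) = F (l0 * l)) : act τ (∏ l ∈ Lam r, F l) = ∏ l ∈ Lam r, F l := by
  obtain ⟨h1, h2, h3⟩ := Lam_bij (r := r) (mem_Lam.2 ⟨τ, hτ⟩)
  rw [map_prod]
  exact Finset.prod_nbij (fun l => l0 * l) h1 h2 h3 hF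

theorem Core.eqv_smul (h : Core p act r g A B c X) {τ : Γ} {l0 : ZMod p}
    (hτ : (r τ).1 = l0 • (1 : Matrix (Fin 2) (Fin 2) (ZMod p))) {v : Fin 2 → ZMod p} (hv : v ≠ 0) :
    act τ (X v) = X (l0 • v) := by
  rw [h.eqv τ v hv, isScal_mulVec hτ]

theorem Core.starr (h : Core p act r g A B c X) :
    ∏ v ∈ univ.filter (fun v : Fin 2 → ZMod p => v ≠ 0), max 1 ‖X v‖ = (p : ℝ) ^ 2 := by
  have hp := h.hp
  refine h.hX.star Fact.out (by omega) (fun v => ?_) ?_ h.h2 h.h3 h.hpK h.hA h.hB h.hred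
  · ext i; simp
  · simp [ZMod.card]

theorem Core.norm_smul_ge (h : Core p act r g A B c X) {v : Fin 2 → ZMod p} (hv : v ≠ 0) (h1 : 1 < ‖X v‖)
    {l : ZMod p} (hl : l ≠ 0) : ‖X v‖ ≤ ‖X (l • v)‖ := by
  have hmem : l • v ∈ h.hX.big h.hA h.hB h.h2 h1 := by
    rw [zsmul_val]
    exact AddSubgroup.nsmul_mem _ (Or.inr le_rfl) _
  rcases hmem with h0 | h0
  · exact absurd h0 (smul_ne_zero hl hv)
  · exact h0

theorem Core.norm_smul (h : Core p act r g A B c X) {v : Fin 2 → ZMod p} (hv : v ≠ 0) (h1 : 1 < ‖X v‖)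
    {l : ZMod p} (hl : l ≠ 0) : ‖X (l • v)‖ = ‖X v‖ := by
  have a := h.norm_smul_ge hv h1 hl
  have b := h.norm_smul_ge (smul_ne_zero hl hv) (h1.trans_le a) (inv_ne_zero hl)
  rw [smul_smul, inv_mul_cancel₀ hl, one_smul] at b
  exact le_antisymm b a

theorem Core.prod_ge (h : Core p act r g A B c X) {s : Finset (Fin 2 → ZMod p)} {R : ℝ} (hR : 1 < R)
    (hs : ∀ v ∈ s, v ≠ 0 ∧ R ≤ ‖X v‖) : R ^ s.card ≤ (p : ℝ) ^ 2 := by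
  rw [← h.starr]
  have hsub : s ⊆ univ.filter (fun v : Fin 2 → ZMod p => v ≠ 0) := fun v hv => by simp [(hs v hv).1]
  rw [← Finset.prod_sdiff hsub]
  have e1 : R ^ s.card ≤ ∏ v ∈ s, max 1 ‖X v‖ := by
    rw [← Finset.prod_const]
    apply Finset.prod_le_prod
    · intros; linarith
    · intro v hv; exact (hs v hv).2.trans (le_max_right _ _)
  have e2 : (1 : ℝ) ≤ ∏ v ∈ (univ.filter (fun v : Fin 2 → ZMod p => v ≠ 0)) \ s, max 1 ‖X v‖ := by
    have : ∏ v ∈ (univ.filter (fun v : Fin 2 → ZMod p => v ≠ 0)) \ s, (1 : ℝ) ≤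
       ∏ v ∈ (univ.filter (fun v : Fin 2 → ZMod p => v ≠ 0)) \ s, max 1 ‖X v‖ := by
      apply Finset.prod_le_prod
      · intros; norm_num
      · intro v hv; exact le_max_left _ _
    simpa using this
  have : 0 ≤ R ^ s.card := by positivity
  nlinarith

theorem um_sum {ι : Type*} (s : Finset ι) (f : ι → K) {R : ℝ} (hR : 0 ≤ R) (hf : ∀ i ∈ s, ‖f i‖ ≤ R) :
    ‖∑ i ∈ s, f i‖ ≤ R := by
  classical
  induction s using Finset.induction_on with
  | empty => simpa using hR
  | insert a s ha ih =>
    rw [Finset.sum_insert ha]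
    exact um_add (hf a (by simp)) (ih (fun i hi => hf i (by simp [hi])))

theorem Core.case1 (h : Core p act r g A B c X) {R : ℝ} (hR : 1 < R) (hall : ∀ w, w ≠ 0 → ‖X w‖ = R) : False := by
  have hp := h.hp
  obtain ⟨z, hz⟩ := h.ss R hR hall
  obtain ⟨c, k, hc, hck, h3, hc0⟩ := card_gset (p := p) (by omega)
  have hst := h.starr
  have e1 : ∏ v ∈ univ.filter (fun v : Fin 2 → ZMod p => v ≠ 0), max 1 ‖X v‖ = R ^ (p ^ 2 - 1) := by
    rw [Finset.prod_congr rfl (g := fun _ => R), Finset.prod_const]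
    · congr 1
      have : (univ.filter (fun v : Fin 2 → ZMod p => v ≠ 0)) = univ.erase 0 := by ext; simp
      rw [this, Finset.card_erase_of_mem (by simp)]
      simp [ZMod.card]
    · intro v hv
      rw [hall v (by simpa using hv), max_eq_right hR.le]
  rw [e1, ← hck] at hst
  rw [hc] at hz
  have e2 : ((p : ℝ) ^ z) ^ k = ((p : ℝ) ^ 2) ^ 4 := by
    rw [← hz, ← hst]; ring
  have hp1 : (1 : ℝ) < p := by exact_mod_cast (show 1 < p by omega)
  have e3 : (p : ℝ) ^ (z * k) = (p : ℝ) ^ (8 : ℤ) := by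
    rw [_root_.zpow_mul, zpow_natCast, e2]; norm_cast; ring
  have e4 : z * k = 8 := zpow_right_injective₀ (by linarith) (by linarith) e3
  obtain ⟨k', rfl⟩ := h3
  have : (3 : ℤ) ∣ 8 := ⟨z * k', by rw [← e4]; push_cast; ring⟩
  norm_num at this

/-- if `1 < R` and `R = p^k` then `p ≤ R`. -/
theorem ge_of_zpow {p : ℕ} (hp : 1 < p) {R : ℝ} (hR : 1 < R) {k : ℤ} (h : R = (p : ℝ) ^ k) : (p : ℝ) ≤ R := by
  have hp1 : (1 : ℝ) < p := by exact_mod_cast hp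
  have hk : 0 < k := by
    by_contra hk
    push Not at hk
    have := zpow_le_one_of_nonpos₀ hp1.le hk
    linarith
  rw [h]
  calc (p : ℝ) = (p : ℝ) ^ (1 : ℤ) := by simp
    _ ≤ _ := zpow_le_zpow_right₀ hp1.le hk

theorem Core.false (h : Core p act r g A B c X) : False := by
  classical
  have hp := h.hp
  have hp1 : (1 : ℝ) < p := by exact_mod_cast (show 1 < p by omega)
  have hst := h.starr
  set S := univ.filter (fun v : Fin 2 → ZMod p => v ≠ 0) with hS
  have hSne : S.Nonempty := by
    refine ⟨fun _ => 1, ?_⟩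
    simp [hS, funext_iff]
  obtain ⟨v1, hv1S, hmax⟩ := S.exists_max_image (fun v => ‖X v‖) hSne
  have hv1 : v1 ≠ 0 := by simpa [hS] using hv1S
  replace hmax : ∀ v, v ≠ 0 → ‖X v‖ ≤ ‖X v1‖ := fun v hv => hmax v (by simp [hS, hv])
  have hR1 : 1 < ‖X v1‖ := by
    by_contra hcon
    push Not at hcon
    rw [Finset.prod_eq_one] at hst
    · nlinarith
    · intro v hv
      exact max_eq_left ((hmax v (by simpa [hS] using hv)).trans hcon)
  by_cases hall : ∀ w, w ≠ 0 → ‖X w‖ = ‖X v1‖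
  · exact h.case1 hR1 hall
  push Not at hall
  obtain ⟨w0, hw0, hw0n⟩ := hall
  have hline : ∀ u, u ≠ 0 → ‖X u‖ = ‖X v1‖ → ∃ l : ZMod p, u = l • v1 := by
    intro u hu hun
    by_contra hcon
    push Not at hcon
    obtain ⟨a, b, hab⟩ := span2 hv1 hcon w0
    have hmem : w0 ∈ h.hX.big h.hA h.hB h.h2 hR1 := by
      rw [hab, zsmul_val, zsmul_val]
      exact add_mem (AddSubgroup.nsmul_mem _ (Or.inr le_rfl) _) (AddSubgroup.nsmul_mem _ (Or.inr hun.ge) _)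
    rcases hmem with hh | hh
    · exact hw0 hh
    · exact hw0n (le_antisymm (hmax w0 hw0) hh)
  have hev : ∀ τ, ∃ l : ZMod p, Matrix.mulVec (r τ).1 v1 = l • v1 := by
    intro τ
    apply hline
    · intro h0
      apply hv1
      have h1 : ((r τ)⁻¹ : GL (Fin 2) (ZMod p)).1 * (r τ).1 = 1 := by rw [← Units.val_mul]; simp
      rw [← Matrix.one_mulVec v1, ← h1, ← Matrix.mulVec_mulVec, h0, Matrix.mulVec_zero]
    · rw [← h.eqv τ v1 hv1, h.iso]
  have hR1p : ‖X v1‖ ^ (p - 1) ≤ (p : ℝ) ^ 2 := by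
    have := h.prod_ge (s := (univ.erase (0 : ZMod p)).image (fun l => l • v1)) hR1 (by
      intro v hv
      simp only [Finset.mem_image, Finset.mem_erase] at hv
      obtain ⟨l, ⟨hl, -⟩, rfl⟩ := hv
      exact ⟨smul_ne_zero hl hv1, h.norm_smul_ge hv1 hR1 hl⟩)
    rwa [Finset.card_image_of_injective _ (smul_left_injective (ZMod p) hv1), Finset.card_erase_of_mem (by simp),
      Finset.card_univ, ZMod.card] at this
  have hR18 : ‖X v1‖ ^ 8 < p := by
    by_contra hcon
    push Not at hcon
    have e1 : ‖X v1‖ ^ 24 ≤ ‖X v1‖ ^ (p - 1) := pow_le_pow_right₀ hR1.le (by omega)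
    have e2 : (p : ℝ) ^ 3 ≤ (‖X v1‖ ^ 8) ^ 3 := by gcongr
    have e3 : (p : ℝ) ^ 2 < p ^ 3 := pow_lt_pow_right₀ hp1 (by norm_num)
    rw [← pow_mul] at e2
    exact absurd (e3.trans_le (e2.trans (e1.trans hR1p))) (lt_irrefl _)
  have hN : ∀ z : K, (∀ τ, IsScal (r τ).1 → act τ z = z) → 1 < ‖z‖ → (p : ℝ) ≤ ‖z‖ ^ 8 := by
    intro z hz hz1
    have hz0 : z ≠ 0 := by rintro rfl; simp at hz1; linarith
    obtain ⟨k, hk⟩ := h.index2 hv1 hev hz0 hz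
    exact ge_of_zpow (by omega) (one_lt_pow₀ hz1 (by norm_num)) hk
  have hQ0 : ∀ Q, (∀ l : ZMod p, Q ≠ l • v1) → Q ≠ 0 := fun Q hQ hh => hQ 0 (by rw [zero_smul, hh])
  have hQs : ∀ Q, (∀ l : ZMod p, Q ≠ l • v1) → ∀ m : ZMod p, m ≠ 0 → (∀ l : ZMod p, m • Q ≠ l • v1) := by
    intro Q hQ m hm l hh
    apply hQ (m⁻¹ * l)
    rw [mul_smul, ← hh, smul_smul, inv_mul_cancel₀ hm, one_smul]
  -- Case 2a
  have hle : ∀ Q, (∀ l : ZMod p, Q ≠ l • v1) → ‖X Q‖ ≤ 1 := by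
    intro Q hQ
    by_contra hcon
    push Not at hcon
    have hQn := hQ0 Q hQ
    have hge : ∀ w, w ≠ 0 → ‖X Q‖ ≤ ‖X w‖ := by
      intro w hw
      obtain ⟨a, b, hab⟩ := span2 hv1 hQ w
      have hmem : w ∈ h.hX.big h.hA h.hB h.h2 hcon := by
        rw [hab, zsmul_val, zsmul_val]
        exact add_mem (AddSubgroup.nsmul_mem _ (Or.inr (hmax Q hQn)) _) (AddSubgroup.nsmul_mem _ (Or.inr le_rfl) _)
      rcases hmem with hh | hh
      · exact absurd hh hw
      · exact hh
    have e1 := h.prod_ge (s := S) hcon (fun v hv => by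
      have : v ≠ 0 := by simpa [hS] using hv
      exact ⟨this, hge v this⟩)
    have hcard : S.card = p ^ 2 - 1 := by
      have : S = univ.erase 0 := by ext; simp [hS]
      rw [this, Finset.card_erase_of_mem (by simp)]
      simp [ZMod.card]
    rw [hcard] at e1
    set z := ∏ l ∈ Lam r, X (l • Q) with hz
    have hzn : ‖z‖ = ‖X Q‖ ^ (Lam r).card := by
      rw [hz, norm_prod, Finset.prod_congr rfl (g := fun _ => ‖X Q‖), Finset.prod_const]
      intro l hl
      exact h.norm_smul hQn hcon (Lam_ne_zero hl)
    have hL1 : 1 ≤ (Lam r).card := Finset.card_pos.2 ⟨1, one_mem_Lam⟩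
    have hLp : (Lam r).card ≤ p - 1 := by
      have : Lam r ⊆ univ.erase 0 := fun l hl => by simp [Lam_ne_zero hl]
      have := Finset.card_le_card this
      rwa [Finset.card_erase_of_mem (by simp), Finset.card_univ, ZMod.card] at this
    have e2 := hN z (by
      rintro τ ⟨l0, hl0⟩
      rw [hz]
      apply Lam_prod_fix hl0
      intro l hl
      rw [h.eqv_smul hl0 (smul_ne_zero (Lam_ne_zero hl) hQn), smul_smul]) (by
        rw [hzn]; exact one_lt_pow₀ hcon (by omega))
    rw [hzn] at e2
    have e3 : (p : ℝ) ^ 3 ≤ ‖X Q‖ ^ (24 * (Lam r).card) := by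
      calc (p : ℝ) ^ 3 ≤ ((‖X Q‖ ^ (Lam r).card) ^ 8) ^ 3 := by gcongr
        _ = _ := by rw [← pow_mul, ← pow_mul]; congr 1; ring
    have e4 : ‖X Q‖ ^ (24 * (Lam r).card) ≤ ‖X Q‖ ^ (p ^ 2 - 1) := by
      apply pow_le_pow_right₀ hcon.le
      have : p ^ 2 - 1 = (p + 1) * (p - 1) := by
        have := Nat.sq_sub_sq p 1
        simpa using this
      rw [this]
      exact Nat.mul_le_mul (by omega) hLp
    have e5 : (p : ℝ) ^ 2 < p ^ 3 := pow_lt_pow_right₀ hp1 (by norm_num)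
    linarith
  have hX1 : ∀ z : K, (∀ τ, IsScal (r τ).1 → act τ z = z) → ‖z‖ ≤ ‖X v1‖ → ‖z‖ ≤ 1 := by
    intro z hz hz1
    by_contra hcon
    push Not at hcon
    have e1 := hN z hz hcon
    have e2 : ‖z‖ ^ 8 ≤ ‖X v1‖ ^ 8 := by gcongr
    linarith
  have hw0C : ∀ l : ZMod p, w0 ≠ l • v1 := by
    intro l hl
    have hl0 : l ≠ 0 := by rintro rfl; rw [zero_smul] at hl; exact hw0 hl
    exact hw0n (by rw [hl, h.norm_smul hv1 hR1 hl0])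
  by_cases hns : ∃ Q, (∀ l : ZMod p, Q ≠ l • v1) ∧ Ns A B (X Q)
  · obtain ⟨Q, hQ, hQns⟩ := hns
    have hQn := hQ0 Q hQ
    have hbound : ∀ T : Finset K, (∀ t ∈ T, ‖t‖ ≤ 1) → ∀ k : ℕ,
        ‖∑ l ∈ Lam r, X (l • v1) * X (l • Q) ^ k * ∏ t ∈ T, (X (l • Q) - t)‖ ≤ 1 := by
      intro T
      induction T using Finset.induction_on with
      | empty =>
        intro _ k
        simp only [Finset.prod_empty, mul_one]
        apply hX1
        · rintro τ ⟨l0, hl0⟩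
          apply Lam_sum_fix (F := fun l => X (l • v1) * X (l • Q) ^ k) hl0
          intro l hl
          simp only [map_mul, map_pow]
          rw [h.eqv_smul hl0 (smul_ne_zero (Lam_ne_zero hl) hQn), smul_smul,
            h.eqv_smul hl0 (smul_ne_zero (Lam_ne_zero hl) hv1), smul_smul]
        · apply um_sum _ _ (norm_nonneg _)
          intro l hl
          rw [norm_mul, h.norm_smul hv1 hR1 (Lam_ne_zero hl)]
          exact mul_le_of_le_one_right (norm_nonneg _) (um_pow (hle _ (hQs Q hQ l (Lam_ne_zero hl))) k)
      | insert t0 T ht0 ih =>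
        intro hT k
        have i1 := ih (fun t ht => hT t (by simp [ht])) (k + 1)
        have i2 := ih (fun t ht => hT t (by simp [ht])) k
        have : ∑ l ∈ Lam r, X (l • v1) * X (l • Q) ^ k * ∏ t ∈ insert t0 T, (X (l • Q) - t) =
          (∑ l ∈ Lam r, X (l • v1) * X (l • Q) ^ (k+1) * ∏ t ∈ T, (X (l • Q) - t)) -
          t0 * (∑ l ∈ Lam r, X (l • v1) * X (l • Q) ^ k * ∏ t ∈ T, (X (l • Q) - t)) := by
          rw [Finset.mul_sum, ← Finset.sum_sub_distrib]
          apply Finset.sum_congr rfl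
          intro l hl
          rw [Finset.prod_insert ht0]
          ring
        rw [this]
        exact um_sub i1 (um_mul (hT t0 (by simp)) i2)
    set T := ((Lam r).image (fun l => X (l • Q))).erase (X Q) with hT
    have hTn : ∀ t ∈ T, ‖t‖ ≤ 1 := by
      intro t ht
      simp only [hT, Finset.mem_erase, Finset.mem_image] at ht
      obtain ⟨-, l, hl, rfl⟩ := ht
      exact hle _ (hQs Q hQ l (Lam_ne_zero hl))
    have hTd : ∀ t ∈ T, ‖X Q - t‖ = 1 := by
      intro t ht
      have htn := hTn t ht
      simp only [hT, Finset.mem_erase, Finset.mem_image] at ht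
      obtain ⟨hne, l, hl, rfl⟩ := ht
      refine le_antisymm (um_sub (hle Q hQ) htn) ?_
      by_contra hcon
      push Not at hcon
      have hl0 := Lam_ne_zero hl
      have hl1 : l ≠ 1 := by rintro rfl; simp at hne
      have hl2 : l ≠ -1 := by
        rintro rfl
        rw [neg_smul, one_smul, h.hX.neg] at hne
        exact hne rfl
      have n1 : Q ≠ l • Q := fun hh => hl1 (smul_left_injective (ZMod p) hQn (by simpa using hh.symm))
      have n2 : Q ≠ -(l • Q) := fun hh => hl2 (smul_left_injective (ZMod p) hQn (by
        simp only [neg_smul, one_smul]; rw [eq_neg_iff_add_eq_zero, add_comm, ← eq_neg_iff_add_eq_zero]; exact hh))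
      rcases h.hX.collision h.hA h.hB h.h2 hQn (smul_ne_zero hl0 hQn) n1 n2 (hle Q hQ) htn hcon hQns with hh | hh
      · have := hle _ (hQs Q hQ (1 + l) (fun h0 => hl2 (by linear_combination h0)))
        rw [add_smul, one_smul] at this
        linarith
      · have := hle _ (hQs Q hQ (1 - l) (fun h0 => hl1 (by linear_combination -h0)))
        rw [sub_smul, one_smul] at this
        linarith
    have hb := hbound T hTn 0
    have hsum : ∑ l ∈ Lam r, X (l • v1) * X (l • Q) ^ 0 * ∏ t ∈ T, (X (l • Q) - t) =
        (((Lam r).filter (fun l => X (l • Q) = X Q)).card : K) * (X v1 * ∏ t ∈ T, (X Q - t)) := by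
      rw [← nsmul_eq_mul, ← Finset.sum_const, Finset.sum_filter]
      apply Finset.sum_congr rfl
      intro l hl
      split_ifs with hc
      · rw [hc, pow_zero, mul_one]
        congr 1
        rcases (h.hX.inj _ _ (smul_ne_zero (Lam_ne_zero hl) hQn) hQn).1 hc with hh | hh
        · have : l = 1 := smul_left_injective (ZMod p) hQn (by simpa using hh)
          rw [this, one_smul]
        · have : l = -1 := smul_left_injective (ZMod p) hQn (by simpa using hh)
          rw [this, neg_smul, one_smul, h.hX.neg]
      · have : ∏ t ∈ T, (X (l • Q) - t) = 0 := by
          apply Finset.prod_eq_zero (i := X (l • Q))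
          · simp only [hT, Finset.mem_erase, Finset.mem_image]
            exact ⟨hc, l, hl, rfl⟩
          · ring
        rw [this, mul_zero]
    have hcard : ‖(((Lam r).filter (fun l => X (l • Q) = X Q)).card : K)‖ = 1 := by
      have hsub : (Lam r).filter (fun l => X (l • Q) = X Q) ⊆ {1, -1} := by
        intro l hl
        rw [Finset.mem_filter] at hl
        rcases (h.hX.inj _ _ (smul_ne_zero (Lam_ne_zero hl.1) hQn) hQn).1 hl.2 with hh | hh
        · have : l = 1 := smul_left_injective (ZMod p) hQn (by simpa using hh)
          simp [this]
        · have : l = -1 := smul_left_injective (ZMod p) hQn (by simpa using hh)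
          simp [this]
      have c1 := (Finset.card_le_card hsub).trans Finset.card_le_two
      have c2 : 0 < ((Lam r).filter (fun l => X (l • Q) = X Q)).card :=
        Finset.card_pos.2 ⟨1, by simp [one_mem_Lam]⟩
      generalize ((Lam r).filter (fun l => X (l • Q) = X Q)).card = n at c1 c2
      interval_cases n
      · simp
      · exact_mod_cast h.h2
    rw [hsum, norm_mul, norm_mul, hcard, norm_prod, Finset.prod_eq_one hTd, one_mul, mul_one] at hb
    linarith
  · push Not at hns
    rcases h.hred with hg | ⟨hAc, hc, hδ⟩
    · exact hns w0 hw0C (ns_of_good h.hA h.hB (hle w0 hw0C) hg)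
    · have hX' : XData (-3 * c ^ 2) (2 * c ^ 3 + (B - 2 * c ^ 3)) X := by
        have := h.hX
        rw [hAc] at this
        rwa [add_sub_cancel]
      have hnear : ∀ Q, (∀ l : ZMod p, Q ≠ l • v1) → ‖X Q - c‖ < 1 := by
        intro Q hQ
        apply near_c_of_not_ns hc hδ h.h2 h.h3 (hle Q hQ)
        rw [add_sub_cancel, ← hAc]
        exact hns Q hQ
      have hfix : ∀ τ, IsScal (r τ).1 → act τ (X v1) = X v1 := by
        rintro τ ⟨l, hl⟩
        have hl0 := scal_ne_zero hl
        rw [h.eqv_smul hl hv1]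
        by_cases hl1 : l = 1
        · rw [hl1, one_smul]
        by_cases hl2 : l = -1
        · rw [hl2, neg_smul, one_smul, h.hX.neg]
        exfalso
        have heq : ‖X w0 - c‖ = ‖X (l • w0) - c‖ := by
          rw [← h.eqv_smul hl hw0, ← h.iso τ (X w0 - c), map_sub, h.actc]
        have n1 : w0 ≠ l • w0 := fun hh => hl1 (smul_left_injective (ZMod p) hw0 (by simpa using hh.symm))
        have n2 : w0 ≠ -(l • w0) := fun hh => hl2 (smul_left_injective (ZMod p) hw0 (by
          simp only [neg_smul, one_smul]; rw [eq_neg_iff_add_eq_zero, add_comm, ← eq_neg_iff_add_eq_zero]; exact hh))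
        rcases hX'.lemmaM hc hδ h.h2 h.h3 hw0 (smul_ne_zero hl0 hw0) n1 n2 heq (hnear w0 hw0C) with hh | hh
        · have := hnear _ (hQs w0 hw0C (1 + l) (fun h0 => hl2 (by linear_combination h0)))
          rw [add_smul, one_smul] at this
          linarith
        · have := hnear _ (hQs w0 hw0C (1 - l) (fun h0 => hl1 (by linear_combination -h0)))
          rw [sub_smul, one_smul] at this
          linarith
      have := hX1 (X v1) hfix le_rfl
      linarith
end core


section xi
variable {F : Type*} [Field F] [CharZero F]

/-- The normalised `x`-coordinate. -/
def xiCoord {W : WeierstrassCurve.Affine F} : W.Point → F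
  | 0 => 0
  | .some x y h => x + W.b₂ / 12

theorem alg_sum {d f1 f2 q1 q2 x1 x2 A B S T : F} (hd : x1 - x2 ≠ 0)
    (h1 : q1 ^ 2 = x1 ^ 3 + A * x1 + B) (h2 : q2 ^ 2 = x2 ^ 3 + A * x2 + B)
    (hS : (x1 - x2) ^ 2 * S = (q1 - q2) ^ 2 - (x1 + x2) * (x1 - x2) ^ 2)
    (hT : (x1 - x2) ^ 2 * T = (q1 + q2) ^ 2 - (x1 + x2) * (x1 - x2) ^ 2) :
    (x1 - x2) ^ 2 * (S + T) = 2 * (x1 * x2 + A) * (x1 + x2) + 4 * B ∧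
    (x1 - x2) ^ 2 * (S * T) = (x1 * x2 - A) ^ 2 - 4 * B * (x1 + x2) := by
  constructor
  · linear_combination hS + hT + 2 * h1 + 2 * h2
  · have hd2 : (x1 - x2) ^ 2 ≠ 0 := pow_ne_zero _ hd
    apply mul_left_cancel₀ hd2
    have e : (x1 - x2) ^ 2 * ((x1 - x2) ^ 2 * (S * T)) =
      (q1 ^ 2 + q2 ^ 2 - (x1 + x2) * (x1 - x2) ^ 2) ^ 2 - 4 * q1 ^ 2 * q2 ^ 2 := by
      calc _ = ((x1 - x2) ^ 2 * S) * ((x1 - x2) ^ 2 * T) := by ring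
        _ = _ := by rw [hS, hT]; ring
    rw [e, h1, h2]
    ring

variable [DecidableEq F] {W : WeierstrassCurve.Affine F}

theorem xi_eq {x y : F} (h : W.Equation x y) :
    (y + (W.a₁ * x + W.a₃) / 2) ^ 2 = (x + W.b₂ / 12) ^ 3 + (-W.c₄ / 48) * (x + W.b₂ / 12) + (-W.c₆ / 864) := by
  rw [WeierstrassCurve.Affine.equation_iff] at h
  simp only [WeierstrassCurve.c₄, WeierstrassCurve.c₆, WeierstrassCurve.b₂, WeierstrassCurve.b₄, WeierstrassCurve.b₆]
  linear_combination h

theorem xi_add {x1 y1 x2 y2 : F} (h1 : W.Nonsingular x1 y1) (h2 : W.Nonsingular x2 y2) (hx : x1 ≠ x2) :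
    (x1 - x2) ^ 2 * xiCoord (WeierstrassCurve.Affine.Point.some x1 y1 h1 + .some x2 y2 h2) =
      ((y1 + (W.a₁ * x1 + W.a₃) / 2) - (y2 + (W.a₁ * x2 + W.a₃) / 2)) ^ 2
       - ((x1 + W.b₂ / 12) + (x2 + W.b₂ / 12)) * (x1 - x2) ^ 2 := by
  rw [WeierstrassCurve.Affine.Point.add_of_X_ne hx]
  have hd : x1 - x2 ≠ 0 := sub_ne_zero.2 hx
  simp only [xiCoord, WeierstrassCurve.Affine.addX, WeierstrassCurve.Affine.slope_of_X_ne hx, WeierstrassCurve.b₂]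
  field_simp
  ring

theorem xi_xdata : XData (-W.c₄ / 48) (-W.c₆ / 864) (xiCoord : W.Point → F) := by
  have key : ∀ P Q : W.Point, P ≠ 0 → Q ≠ 0 → P ≠ Q → P ≠ -Q →
      (xiCoord P - xiCoord Q) ^ 2 * (xiCoord (P + Q) + xiCoord (P - Q)) =
        2 * (xiCoord P * xiCoord Q + (-W.c₄ / 48)) * (xiCoord P + xiCoord Q) + 4 * (-W.c₆ / 864) ∧
      (xiCoord P - xiCoord Q) ^ 2 * (xiCoord (P + Q) * xiCoord (P - Q)) =
        (xiCoord P * xiCoord Q - (-W.c₄ / 48)) ^ 2 - 4 * (-W.c₆ / 864) * (xiCoord P + xiCoord Q) := by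
    rintro (_ | ⟨x1, y1, h1⟩) (_ | ⟨x2, y2, h2⟩) hP hQ hPQ hn
    · exact absurd rfl hP
    · exact absurd rfl hP
    · exact absurd rfl hQ
    have hx : x1 ≠ x2 := by
      intro hx
      rcases (WeierstrassCurve.Affine.Point.X_eq_iff (h₁ := h1) (h₂ := h2)).1 hx with h | h
      · exact hPQ h
      · exact hn h
    have eS := xi_add h1 h2 hx
    have eT := xi_add h1 ((WeierstrassCurve.Affine.nonsingular_neg ..).mpr h2) hx
    rw [← WeierstrassCurve.Affine.Point.neg_some h2, ← sub_eq_add_neg] at eT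
    have hd : (x1 + W.b₂ / 12) - (x2 + W.b₂ / 12) ≠ 0 := by
      rw [add_sub_add_right_eq_sub]; exact sub_ne_zero.2 hx
    have := alg_sum (d := 0) (f1 := 0) (f2 := 0) (q1 := y1 + (W.a₁ * x1 + W.a₃) / 2)
      (q2 := y2 + (W.a₁ * x2 + W.a₃) / 2) hd (xi_eq h1.1) (xi_eq h2.1)
      (S := xiCoord (WeierstrassCurve.Affine.Point.some x1 y1 h1 + .some x2 y2 h2))
      (T := xiCoord (WeierstrassCurve.Affine.Point.some x1 y1 h1 - .some x2 y2 h2))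
      (by rw [add_sub_add_right_eq_sub]; exact eS)
      (by
        rw [add_sub_add_right_eq_sub, eT]
        simp only [WeierstrassCurve.Affine.negY]
        ring)
    exact this
  have hne : ∀ P : W.Point, P ≠ 0 → P ≠ -P → xiCoord P ^ 3 + (-W.c₄ / 48) * xiCoord P + (-W.c₆ / 864) ≠ 0 := by
    rintro (_ | ⟨x1, y1, h1⟩) hP hn
    · exact absurd rfl hP
    show (x1 + W.b₂ / 12) ^ 3 + (-W.c₄ / 48) * (x1 + W.b₂ / 12) + (-W.c₆ / 864) ≠ 0
    rw [← xi_eq h1.1]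
    intro h0
    have h0' := pow_eq_zero_iff (two_ne_zero) |>.1 h0
    apply hn
    rw [WeierstrassCurve.Affine.Point.neg_some, WeierstrassCurve.Affine.Point.some.injEq]
    refine ⟨rfl, ?_⟩
    simp only [WeierstrassCurve.Affine.negY]
    linear_combination 2 * h0'
  refine ⟨?_, fun P Q a b c d => (key P Q a b c d).1, fun P Q a b c d => (key P Q a b c d).2, ?_, hne⟩
  · rintro (_ | ⟨x1, y1, h1⟩) (_ | ⟨x2, y2, h2⟩) hP hQ
    · exact absurd rfl hP
    · exact absurd rfl hP
    · exact absurd rfl hQ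
    rw [← WeierstrassCurve.Affine.Point.X_eq_iff]
    simp [xiCoord]
  · intro P hP hn
    have hf := hne P hP hn
    rcases P with _ | ⟨x1, y1, h1⟩
    · exact absurd rfl hP
    have hy : y1 ≠ W.negY x1 y1 := by
      intro hy
      apply hn
      rw [WeierstrassCurve.Affine.Point.neg_some, WeierstrassCurve.Affine.Point.some.injEq]
      exact ⟨rfl, hy⟩
    have e := xi_eq h1.1
    have hq : y1 + (W.a₁ * x1 + W.a₃) / 2 ≠ 0 := by
      intro h0
      apply hy
      simp only [WeierstrassCurve.Affine.negY]
      linear_combination 2 * h0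
    have hx : xiCoord (WeierstrassCurve.Affine.Point.some x1 y1 h1) = x1 + W.b₂ / 12 := rfl
    rw [hx, ← e, WeierstrassCurve.Affine.Point.add_self_of_Y_ne hy]
    set q := y1 + (W.a₁ * x1 + W.a₃) / 2 with hqd
    have hL : W.slope x1 x1 y1 y1 = (3 * x1 ^ 2 + 2 * W.a₂ * x1 + W.a₄ - W.a₁ * y1) / (2 * q) := by
      rw [WeierstrassCurve.Affine.slope_of_Y_ne rfl hy]
      congr 1
      simp only [WeierstrassCurve.Affine.negY, hqd]; ring
    have hL2 : 2 * q * W.slope x1 x1 y1 y1 = (3 * x1 ^ 2 + 2 * W.a₂ * x1 + W.a₄ - W.a₁ * y1) := by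
      rw [hL]; field_simp
    have hL3 : 2 * q * (W.slope x1 x1 y1 y1 + W.a₁ / 2) = 3 * (x1 + W.b₂ / 12) ^ 2 + (-W.c₄ / 48) := by
      simp only [WeierstrassCurve.c₄, WeierstrassCurve.b₂, WeierstrassCurve.b₄]
      linear_combination hL2 + W.a₁ * hqd
    have hx2 : xiCoord (WeierstrassCurve.Affine.Point.some _ _ (WeierstrassCurve.Affine.nonsingular_add h1 h1 fun hxy => hy hxy.right))
      = (W.slope x1 x1 y1 y1 + W.a₁ / 2) ^ 2 - 2 * (x1 + W.b₂ / 12) := by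
      simp only [xiCoord, WeierstrassCurve.Affine.addX, WeierstrassCurve.b₂]
      ring
    rw [hx2]
    calc 4 * q ^ 2 * ((W.slope x1 x1 y1 y1 + W.a₁ / 2) ^ 2 - 2 * (x1 + W.b₂ / 12))
        = (2 * q * (W.slope x1 x1 y1 y1 + W.a₁ / 2)) ^ 2 - 8 * q ^ 2 * (x1 + W.b₂ / 12) := by ring
      _ = _ := by rw [hL3, e]; ring
end xi

section xtrans
variable {F K M N : Type*} [Field F] [Field K] [AddCommGroup M] [AddCommGroup N] {A B : F} {X : M → F}

theorem XData.comp (hX : XData A B X) (f : N →+ M) (hf : Function.Injective f) : XData A B (fun v => X (f v)) := by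
  have h0 : ∀ {v}, v ≠ 0 → f v ≠ 0 := fun {v} hv h => hv (hf (by rw [h, map_zero]))
  have hn : ∀ {v w}, v ≠ w → f v ≠ f w := fun h h' => h (hf h')
  have hm : ∀ {v w}, v ≠ -w → f v ≠ - f w := fun h h' => h (hf (by rw [h', map_neg]))
  constructor
  · intro P Q hP hQ
    rw [hX.inj _ _ (h0 hP) (h0 hQ), ← map_neg, hf.eq_iff, hf.eq_iff]
  · intro P Q a b c d
    rw [map_add, map_sub]; exact hX.sum _ _ (h0 a) (h0 b) (hn c) (hm d)
  · intro P Q a b c d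
    rw [map_add, map_sub]; exact hX.prod _ _ (h0 a) (h0 b) (hn c) (hm d)
  · intro P a b
    rw [map_add]; exact hX.dbl _ (h0 a) (hm b)
  · intro P a b
    exact hX.ne _ (h0 a) (hm b)

theorem XData.scale (hX : XData A B X) (f : F →+* K) {s : K} (hs : s ≠ 0) :
    XData (f A / s ^ 2) (f B / s ^ 3) (fun v => f (X v) / s) := by
  constructor
  · intro P Q hP hQ
    rw [← hX.inj _ _ hP hQ, div_left_inj' hs, f.injective.eq_iff]
  · intro P Q a b c d
    have := congrArg f (hX.sum P Q a b c d)
    simp only [map_mul, map_add, map_sub, map_pow, map_ofNat] at this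
    field_simp
    linear_combination this
  · intro P Q a b c d
    have := congrArg f (hX.prod P Q a b c d)
    simp only [map_mul, map_add, map_sub, map_pow, map_ofNat] at this
    field_simp
    linear_combination this
  · intro P a b
    have := congrArg f (hX.dbl P a b)
    simp only [map_mul, map_add, map_sub, map_pow, map_ofNat] at this
    field_simp
    linear_combination this
  · intro P a b h
    apply hX.ne P a b
    apply f.injective
    rw [map_zero]
    simp only [map_mul, map_add, map_pow]
    have : (f (X P) ^ 3 + f A * f (X P) + f B) / s ^ 3 = 0 := by
      rw [← h]; field_simp
    rcases div_eq_zero_iff.1 this with h | h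
    · exact h
    · exact absurd h (pow_ne_zero _ hs)
end xtrans


section padic
variable {p : ℕ} [Fact p.Prime]

theorem pac_iso (σ : PadicAlgCl p ≃ₐ[ℚ_[p]] PadicAlgCl p) (z : PadicAlgCl p) : ‖σ z‖ = ‖z‖ := by
  rw [← PadicAlgCl.spectralNorm_eq, ← PadicAlgCl.spectralNorm_eq]
  exact (spectralNorm_eq_of_equiv σ z).symm

theorem pac_fix (z : PadicAlgCl p) (hz : z ≠ 0)
    (h : ∀ σ : PadicAlgCl p ≃ₐ[ℚ_[p]] PadicAlgCl p, σ z = z) : ∃ k : ℤ, ‖z‖ = (p : ℝ) ^ k := by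
  obtain ⟨x, rfl⟩ := (InfiniteGalois.mem_range_algebraMap_iff_fixed z).2 h
  have hx : x ≠ 0 := by rintro rfl; simp at hz
  refine ⟨-x.valuation, ?_⟩
  rw [← Padic.norm_eq_zpow_neg_valuation hx]
  exact PadicAlgCl.norm_extends p x

theorem pac_index2 (H : Subgroup (PadicAlgCl p ≃ₐ[ℚ_[p]] PadicAlgCl p)) (t : PadicAlgCl p)
    (ht : ∀ τ ∈ H, τ t = t ∨ τ t = -t) (m : ℕ)
    (hH : ∀ z : PadicAlgCl p, z ≠ 0 → (∀ τ ∈ H, τ z = z) → ∃ k : ℤ, ‖z‖ ^ m = (p : ℝ) ^ k)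
    (z : PadicAlgCl p) (hz : z ≠ 0) (hf : ∀ τ ∈ H, τ t = t → τ z = z) :
    ∃ k : ℤ, ‖z‖ ^ (2 * m) = (p : ℝ) ^ k := by
  by_cases hall : ∀ τ ∈ H, τ z = z
  · obtain ⟨k, hk⟩ := hH z hz hall
    refine ⟨k * 2, ?_⟩
    rw [mul_comm 2 m, pow_mul, hk, _root_.zpow_mul]; norm_cast
  · push Not at hall
    obtain ⟨a, ha, haz⟩ := hall
    have hat : a t = -t := (ht a ha).resolve_left (fun h => haz (hf a ha h))
    have hait : a⁻¹ t = -t := by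
      have : a⁻¹ (a t) = t := by
        rw [← AlgEquiv.mul_apply]; simp
      rw [hat, map_neg] at this
      rw [← neg_eq_iff_eq_neg, this]
    have hu : z * a z ≠ 0 := mul_ne_zero hz (by simpa using hz)
    obtain ⟨k, hk⟩ := hH (z * a z) hu (by
      intro τ hτ
      rw [map_mul]
      rcases ht τ hτ with h | h
      · rw [hf τ hτ h]
        have h1 : (a⁻¹ * τ * a) z = z := by
          apply hf _ (H.mul_mem (H.mul_mem (H.inv_mem ha) hτ) ha)
          simp only [AlgEquiv.mul_apply, hat, map_neg, h, hait, neg_neg]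
        have h2 : τ (a z) = a ((a⁻¹ * τ * a) z) := by
          rw [← AlgEquiv.mul_apply, ← AlgEquiv.mul_apply]; congr 1; group
        rw [h2, h1]
      · have h1 : (a⁻¹ * τ) z = z := by
          apply hf _ (H.mul_mem (H.inv_mem ha) hτ)
          simp only [AlgEquiv.mul_apply, h, map_neg, hait, neg_neg]
        have h2 : τ z = a ((a⁻¹ * τ) z) := by
          rw [← AlgEquiv.mul_apply]; congr 1; group
        have h3 : (τ * a) z = z := by
          apply hf _ (H.mul_mem hτ ha)
          simp only [AlgEquiv.mul_apply, hat, map_neg, h, neg_neg]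
        rw [h2, h1, ← AlgEquiv.mul_apply, h3, mul_comm])
    refine ⟨k, ?_⟩
    rw [← hk, norm_mul, pac_iso, pow_mul]; congr 1; ring

theorem pac_rat (q : ℚ) (hq : q ≠ 0) : ‖(q : PadicAlgCl p)‖ = (p : ℝ) ^ (-padicValRat p q) := by
  have h : (q : PadicAlgCl p) = algebraMap ℚ_[p] (PadicAlgCl p) (q : ℚ_[p]) := by simp
  rw [h]
  have := PadicAlgCl.norm_extends p (q : ℚ_[p])
  refine this.trans ?_
  rw [Padic.eq_padicNorm, padicNorm.eq_zpow_of_nonzero hq]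
  push_cast; rfl

theorem pac_nat (n : ℕ) (h : Nat.Coprime n p) : ‖(n : PadicAlgCl p)‖ = 1 := by
  have hn : n ≠ 0 := by
    rintro rfl
    have := (Fact.out : p.Prime).one_lt
    simp at h; omega
  have := pac_rat (p := p) (n : ℚ) (by exact_mod_cast hn)
  rw [padicValRat.of_nat, padicValNat.eq_zero_of_not_dvd] at this
  · simpa using this
  · exact fun hd => (Nat.Prime.coprime_iff_not_dvd Fact.out).1 h.symm hd

theorem pac_p : ‖(p : PadicAlgCl p)‖ = (p : ℝ)⁻¹ := by
  have h0 := (Fact.out : p.Prime).ne_zero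
  have := pac_rat (p := p) (p : ℚ) (by exact_mod_cast h0)
  rw [padicValRat.self (Fact.out : p.Prime).one_lt] at this
  simpa using this

theorem qbar_alg : Algebra.IsAlgebraic ℚ Qbar := by
  have h : @Algebra.IsAlgebraic ℚ Qbar _ _ (AlgebraicClosure.instAlgebra ℚ) := AlgebraicClosure.isAlgebraic ℚ
  convert h
  exact Subsingleton.elim _ _

theorem qbar_galois : IsGalois ℚ Qbar := by
  have h : @IsGalois ℚ _ Qbar _ (AlgebraicClosure.instAlgebra ℚ) := inferInstance
  convert h
  exact Subsingleton.elim _ _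

theorem pac_embed : ∃ (ι : Qbar →+* PadicAlgCl p)
    (res : (PadicAlgCl p ≃ₐ[ℚ_[p]] PadicAlgCl p) →* (Qbar ≃ₐ[ℚ] Qbar)),
    ∀ σ x, ι (res σ x) = σ (ι x) := by
  haveI := qbar_alg
  haveI := qbar_galois
  let ι : Qbar →ₐ[ℚ] PadicAlgCl p := IsAlgClosed.lift
  letI : Algebra Qbar (PadicAlgCl p) := ι.toRingHom.toAlgebra
  haveI : IsScalarTower ℚ Qbar (PadicAlgCl p) := IsScalarTower.of_algebraMap_eq (fun x => by
    exact (ι.commutes x).symm)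
  refine ⟨ι, (AlgEquiv.restrictNormalHom (F := ℚ) (K₁ := PadicAlgCl p) Qbar).comp
    (AlgEquiv.restrictScalarsHom ℚ), fun σ x => ?_⟩
  exact AlgEquiv.restrictNormal_commutes (AlgEquiv.restrictScalars ℚ σ) Qbar x

theorem qbar_fix (x : Qbar) (h : ∀ σ : Qbar ≃ₐ[ℚ] Qbar, σ x = x) : ∃ q : ℚ, x = (q : Qbar) := by
  haveI := qbar_galois
  obtain ⟨q, hq⟩ := (InfiniteGalois.mem_range_algebraMap_iff_fixed x).2 h
  exact ⟨q, by rw [← hq]; simp⟩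

end padic


section norm
variable {p : ℕ} [Fact p.Prime]

/-- The subgroup of `G` fixing `s` and `c`. -/
def stab2 (s c : PadicAlgCl p) : Subgroup (PadicAlgCl p ≃ₐ[ℚ_[p]] PadicAlgCl p) where
  carrier := {τ | τ s = s ∧ τ c = c}
  one_mem' := ⟨rfl, rfl⟩
  mul_mem' := by
    rintro a b ⟨h1, h2⟩ ⟨h3, h4⟩
    exact ⟨by rw [AlgEquiv.mul_apply, h3, h1], by rw [AlgEquiv.mul_apply, h4, h2]⟩
  inv_mem' := by
    rintro a ⟨h1, h2⟩
    constructor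
    · nth_rewrite 1 [← h1]; rw [← AlgEquiv.mul_apply]; simp
    · nth_rewrite 1 [← h2]; rw [← AlgEquiv.mul_apply]; simp

theorem pm_of_sq {t : PadicAlgCl p} {q : ℚ} (h : t ^ 2 = (q : PadicAlgCl p))
    (τ : PadicAlgCl p ≃ₐ[ℚ_[p]] PadicAlgCl p) : τ t = t ∨ τ t = -t := by
  apply sq_eq_sq_iff_eq_or_eq_neg.1
  rw [← map_pow, h, map_ratCast]

theorem stab2_fix {s c : PadicAlgCl p} {q1 q2 : ℚ} (hs : s ^ 2 = (q1 : PadicAlgCl p))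
    (hc : c ^ 2 = (q2 : PadicAlgCl p)) (z : PadicAlgCl p) (hz : z ≠ 0)
    (hf : ∀ τ ∈ stab2 s c, τ z = z) : ∃ k : ℤ, ‖z‖ ^ 4 = (p : ℝ) ^ k := by
  have h1 := pac_index2 (p := p) (stab2 s 0) c (fun τ _ => pm_of_sq hc τ) 2
    (fun z hz hf => pac_index2 ⊤ s (fun τ _ => pm_of_sq hs τ) 1
      (fun z hz hf => by
        obtain ⟨k, hk⟩ := pac_fix z hz (fun σ => hf σ trivial)
        exact ⟨k, by rw [pow_one, hk]⟩) z hz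
      (fun τ _ h => hf τ ⟨h, map_zero _⟩)) z hz
    (fun τ h h' => hf τ ⟨h.1, h'⟩)
  simpa using h1

theorem norm_step (hp : 3 < p) (A B : ℚ) (hA : A ≠ 0) (hD : 4 * A ^ 3 + 27 * B ^ 2 ≠ 0)
    (h : (3 ∣ padicValRat p (4 * A ^ 3 + 27 * B ^ 2) ∧
        padicValRat p (4 * A ^ 3 + 27 * B ^ 2) ≤ 3 * padicValRat p A) ∨
      3 * padicValRat p A < padicValRat p (4 * A ^ 3 + 27 * B ^ 2)) :
    ∃ (m : ℤ) (s c : PadicAlgCl p) (q : ℚ), s ≠ 0 ∧ s ^ 2 = (((p : ℚ) ^ m : ℚ) : PadicAlgCl p) ∧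
      ‖(A : PadicAlgCl p) / s ^ 2‖ ≤ 1 ∧ ‖(B : PadicAlgCl p) / s ^ 3‖ ≤ 1 ∧
      RedType ((A : PadicAlgCl p) / s ^ 2) ((B : PadicAlgCl p) / s ^ 3) c ∧
      c ^ 2 = (q : PadicAlgCl p) := by
  have hp0 : (p : ℚ) ≠ 0 := by exact_mod_cast (Fact.out : p.Prime).ne_zero
  have hpr : (1 : ℝ) < p := by exact_mod_cast (Fact.out : p.Prime).one_lt
  have hpr0 : (p : ℝ) ≠ 0 := by positivity
  have hpp : p.Prime := Fact.out
  have h2 : ‖(2 : PadicAlgCl p)‖ = 1 := by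
    have := pac_nat (p := p) 2 ((Nat.coprime_primes Nat.prime_two hpp).2 (by omega)); simpa using this
  have h3 : ‖(3 : PadicAlgCl p)‖ = 1 := by
    have := pac_nat (p := p) 3 ((Nat.coprime_primes Nat.prime_three hpp).2 (by omega)); simpa using this
  have h4 : ‖(4 : PadicAlgCl p)‖ = 1 := by
    have : (4 : PadicAlgCl p) = 2 ^ 2 := by norm_num
    rw [this, norm_pow, h2, one_pow]
  have h27 : ‖(27 : PadicAlgCl p)‖ = 1 := by
    have : (27 : PadicAlgCl p) = 3 ^ 3 := by norm_num
    rw [this, norm_pow, h3, one_pow]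
  -- generic
  have gen : ∀ m : ℤ, ∃ s : PadicAlgCl p, s ≠ 0 ∧ s ^ 2 = (((p : ℚ) ^ m : ℚ) : PadicAlgCl p) ∧
      ‖s‖ ^ 2 = (p : ℝ) ^ (-m) ∧
      ‖(A : PadicAlgCl p) / s ^ 2‖ = (p : ℝ) ^ (m - padicValRat p A) ∧
      ‖4 * ((A : PadicAlgCl p) / s ^ 2) ^ 3 + 27 * ((B : PadicAlgCl p) / s ^ 3) ^ 2‖
        = (p : ℝ) ^ (3 * m - padicValRat p (4 * A ^ 3 + 27 * B ^ 2)) := by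
    intro m
    obtain ⟨s, hs⟩ := IsAlgClosed.exists_pow_nat_eq (((p : ℚ) ^ m : ℚ) : PadicAlgCl p) (n := 2) (by norm_num)
    have hm0 : ((p : ℚ) ^ m : ℚ) ≠ 0 := zpow_ne_zero _ hp0
    have hs0 : s ≠ 0 := by
      rintro rfl
      have : (((p : ℚ) ^ m : ℚ) : PadicAlgCl p) ≠ 0 := by exact_mod_cast hm0
      apply this; rw [← hs]; simp
    have hn : ‖s‖ ^ 2 = (p : ℝ) ^ (-m) := by
      rw [← norm_pow, hs, pac_rat _ hm0, padicValRat.zpow, padicValRat.self hpp.one_lt]; simp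
    refine ⟨s, hs0, hs, hn, ?_, ?_⟩
    · rw [norm_div, pac_rat _ hA, norm_pow, hn, ← zpow_sub₀ hpr0]; congr 1; ring
    · have : 4 * ((A : PadicAlgCl p) / s ^ 2) ^ 3 + 27 * ((B : PadicAlgCl p) / s ^ 3) ^ 2 =
          ((4 * A ^ 3 + 27 * B ^ 2 : ℚ) : PadicAlgCl p) / (s ^ 2) ^ 3 := by
        push_cast; field_simp
      rw [this, norm_div, pac_rat _ hD, norm_pow, norm_pow, hn, show ((p : ℝ) ^ (-m)) ^ 3 = (p : ℝ) ^ (-m * 3) by rw [_root_.zpow_mul]; norm_cast, ← zpow_sub₀ hpr0]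
      congr 1; ring
  have bB : ∀ a b : PadicAlgCl p, ‖a‖ ≤ 1 → ‖4 * a ^ 3 + 27 * b ^ 2‖ ≤ 1 → ‖b‖ ≤ 1 := by
    intro a b ha hd
    have e : 27 * b ^ 2 = (4 * a ^ 3 + 27 * b ^ 2) - 4 * a ^ 3 := by ring
    have h1 : ‖4 * a ^ 3‖ ≤ 1 := by
      rw [norm_mul, h4, one_mul, norm_pow]; exact pow_le_one₀ (norm_nonneg _) ha
    have h2 : ‖27 * b ^ 2‖ ≤ 1 := by
      rw [e]; exact um_sub hd h1
    rw [norm_mul, h27, one_mul, norm_pow] at h2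
    exact (pow_le_one_iff_of_nonneg (norm_nonneg _) (by norm_num)).1 h2
  rcases h with ⟨⟨m, hm⟩, hle⟩ | hlt
  · obtain ⟨s, hs0, hs, hn, ha, hd⟩ := gen m
    rw [hm] at hle
    rw [hm, sub_self, zpow_zero] at hd
    have ha1 : ‖(A : PadicAlgCl p) / s ^ 2‖ ≤ 1 := by
      rw [ha]; exact zpow_le_one_of_nonpos₀ hpr.le (by omega)
    exact ⟨m, s, 0, 0, hs0, hs, ha1, bB _ _ ha1 hd.le, Or.inl hd, by simp⟩
  · obtain ⟨s, hs0, hs, hn, ha, hd⟩ := gen (padicValRat p A)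
    rw [sub_self, zpow_zero] at ha
    have hd1 : ‖4 * ((A : PadicAlgCl p) / s ^ 2) ^ 3 + 27 * ((B : PadicAlgCl p) / s ^ 3) ^ 2‖ < 1 := by
      rw [hd]; exact zpow_lt_one_of_neg₀ hpr (by omega)
    have hb := bB _ _ ha.le hd1.le
    have key : ∃ c : PadicAlgCl p, c ^ 2 = -((A : PadicAlgCl p) / s ^ 2) / 3 ∧
        ‖(B : PadicAlgCl p) / s ^ 3 - 2 * c ^ 3‖ < 1 := by
      obtain ⟨c, hc⟩ := IsAlgClosed.exists_pow_nat_eq (-((A : PadicAlgCl p) / s ^ 2) / 3) (n := 2) (by norm_num)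
      have hA' : (A : PadicAlgCl p) / s ^ 2 = -3 * c ^ 2 := by rw [hc]; ring
      rw [hA'] at hd1
      generalize (B : PadicAlgCl p) / s ^ 3 = b at hd1
      have e : 4 * (-3 * c ^ 2) ^ 3 + 27 * b ^ 2 = 27 * ((b - 2 * c ^ 3) * (b - 2 * (-c) ^ 3)) := by ring
      rw [e, norm_mul, h27, one_mul, norm_mul] at hd1
      by_contra hcon
      push Not at hcon
      have a1 := hcon c hc
      have a2 := hcon (-c) (by rw [neg_sq, hc])
      nlinarith
    obtain ⟨c, hc, hcb⟩ := key
    refine ⟨_, s, c, -(A / (p : ℚ) ^ (padicValRat p A)) / 3, hs0, hs, ha.le, hb, Or.inr ⟨?_, ?_, hcb⟩, ?_⟩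
    · rw [hc]; ring
    · have : ‖c‖ ^ 2 = 1 := by rw [← norm_pow, hc, norm_div, norm_neg, ha, h3, div_one]
      exact (pow_eq_one_iff_of_nonneg (norm_nonneg _) (by norm_num)).1 this
    · rw [hc, hs]; push_cast; rfl
end norm


section asm

theorem xi_gal (E : WeierstrassCurve ℚ) (σ : Qbar ≃ₐ[ℚ] Qbar) (P : (E⁄Qbar).Point) :
    xiCoord (galAct E σ P) = σ (xiCoord P) := by
  have hb : (E⁄Qbar).b₂ = algebraMap ℚ Qbar E.b₂ := E.map_b₂ _
  rcases P with _ | ⟨x, y, h⟩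
  · change (0 : Qbar) = σ 0
    simp
  · change σ x + (E⁄Qbar).b₂ / 12 = σ (x + (E⁄Qbar).b₂ / 12)
    rw [hb, map_add, map_div₀, AlgEquiv.commutes, map_ofNat]

open scoped Classical in
theorem asm_xi (E : WeierstrassCurve ℚ) {p : ℕ} [Fact p.Prime]
    (ρ : (Qbar ≃ₐ[ℚ] Qbar) →* GL (Fin 2) (ZMod p)) (hρ : IsModPRep E p ρ) :
    ∃ ξ : (Fin 2 → ZMod p) → Qbar,
      XData (((-E.c₄ / 48 : ℚ)) : Qbar) (((-E.c₆ / 864 : ℚ)) : Qbar) ξ ∧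
      ∀ σ v, σ (ξ v) = ξ (Matrix.mulVec (ρ σ).1 v) := by
  obtain ⟨e, he⟩ := hρ
  have h4 : (E⁄Qbar).c₄ = algebraMap ℚ Qbar E.c₄ := E.map_c₄ _
  have h6 : (E⁄Qbar).c₆ = algebraMap ℚ Qbar E.c₆ := E.map_c₆ _
  refine ⟨fun v => xiCoord ((e.symm v).1), ?_, ?_⟩
  · have h := xi_xdata (W := (E⁄Qbar))
    have h2 := XData.comp h ((pTorsion E p).subtype.comp e.symm.toAddMonoidHom)
      (by
        intro a b hab
        exact e.symm.injective (Subtype.ext hab))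
    have e1 : -(E⁄Qbar).c₄ / 48 = (((-E.c₄ / 48 : ℚ)) : Qbar) := by rw [h4]; simp
    have e2 : -(E⁄Qbar).c₆ / 864 = (((-E.c₆ / 864 : ℚ)) : Qbar) := by rw [h6]; simp
    rw [← e1, ← e2]
    exact h2
  · intro σ v
    have hm : galAct E σ (e.symm v).1 ∈ pTorsion E p := by
      have h0 : p • (e.symm v).1 = 0 := (e.symm v).2
      change p • galAct E σ (e.symm v).1 = 0
      rw [← map_nsmul, h0, map_zero]
    have h1 := he σ (e.symm v) hm
    rw [AddEquiv.apply_symm_apply] at h1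
    have h2 : e.symm (Matrix.mulVec (ρ σ).1 v) = ⟨galAct E σ (e.symm v).1, hm⟩ := by
      rw [← h1, AddEquiv.symm_apply_apply]
    beta_reduce
    rw [h2, xi_gal]

theorem asm_ss {p : ℕ} [Fact p.Prime] (ρ : (Qbar ≃ₐ[ℚ] Qbar) →* GL (Fin 2) (ZMod p))
    (himg : ImageConjTo ρ (Gset p)) (ξ : (Fin 2 → ZMod p) → Qbar)
    (hξ : ∀ σ v, σ (ξ v) = ξ (Matrix.mulVec (ρ σ).1 v))
    (ι : Qbar →+* PadicAlgCl p) (R : ℝ) (hR : 0 < R) (hw : ∀ w, w ≠ 0 → ‖ι (ξ w)‖ = R) :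
    ∃ k : ℤ, R ^ (Nat.card (Gset p)) = (p : ℝ) ^ k := by
  classical
  obtain ⟨g, hg⟩ := himg
  have hcard : Nat.card ρ.range = Nat.card (Gset p) := by
    have h1 : Nat.card ρ.range = (Set.range ρ).ncard := rfl
    rw [h1, hg, Set.ncard_image_of_injective, Nat.card_coe_set_eq]
    intro a b h
    simpa using h
  haveI : Fintype ρ.range := Fintype.ofFinite _
  let v : Fin 2 → ZMod p := ![1, 0]
  have hv : v ≠ 0 := fun h => by simpa [v] using congrFun h 0
  have hMv : ∀ M : GL (Fin 2) (ZMod p), Matrix.mulVec M.1 v ≠ 0 := by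
    intro M h
    apply hv
    have : Matrix.mulVec (M⁻¹).1 (Matrix.mulVec M.1 v) = v := by
      rw [Matrix.mulVec_mulVec, ← Units.val_mul]; simp
    rw [← this, h, Matrix.mulVec_zero]
  obtain ⟨q, hq⟩ := qbar_fix (∏ M : ρ.range, ξ (Matrix.mulVec M.1.1 v)) (by
    intro σ
    rw [map_prod]
    let a : ρ.range := ⟨ρ σ, σ, rfl⟩
    rw [← Equiv.prod_comp (Equiv.mulLeft a) (fun M : ρ.range => ξ (Matrix.mulVec M.1.1 v))]
    apply Finset.prod_congr rfl
    intro M _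
    rw [hξ, Matrix.mulVec_mulVec]
    rfl)
  have hn : ‖ι (q : Qbar)‖ = R ^ (Nat.card (Gset p)) := by
    rw [← hq, map_prod, norm_prod, Finset.prod_congr rfl (fun M _ => hw _ (hMv M.1)), Finset.prod_const,
      Finset.card_univ, ← hcard, Nat.card_eq_fintype_card]
  have hq0 : q ≠ 0 := by
    rintro rfl
    have := pow_pos hR (Nat.card (Gset p))
    rw [← hn] at this
    simp at this
  exact ⟨_, by rw [← hn, map_ratCast, pac_rat q hq0]⟩

end asm

theorem three_not_dvd_padicValRat_j (E : WeierstrassCurve ℚ) [E.IsElliptic]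
    (hE : E.j ∉ CMjInvariants) (p : ℕ) (hp : p.Prime) (hp37 : 37 < p)
    (ρ : (Qbar ≃ₐ[ℚ] Qbar) →* GL (Fin 2) (ZMod p)) (hρ : IsModPRep E p ρ)
    (himg : ImageConjTo ρ (Gset p)) :
    ¬ (3 ∣ padicValRat p E.j) ∧ 0 < padicValRat p E.j := by
  haveI : Fact p.Prime := ⟨hp⟩
  by_contra hcon
  have hj0 : E.j ≠ 0 := by
    intro h; apply hE; rw [h]; simp [CMjInvariants]
  have hΔ : E.Δ ≠ 0 := E.isUnit_Δ.ne_zero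
  have hj : E.j = E.c₄ ^ 3 / E.Δ := by
    rw [WeierstrassCurve.j, div_eq_inv_mul, Units.val_inv_eq_inv_val, WeierstrassCurve.coe_Δ']
  obtain ⟨A, hAdef⟩ : ∃ A : ℚ, A = -E.c₄ / 48 := ⟨_, rfl⟩
  obtain ⟨B, hBdef⟩ : ∃ B : ℚ, B = -E.c₆ / 864 := ⟨_, rfl⟩
  have hDe : 4 * A ^ 3 + 27 * B ^ 2 = -E.Δ / 16 := by
    have := E.c_relation
    rw [hAdef, hBdef]
    linear_combination (1 / 27648 : ℚ) * this
  have hD : 4 * A ^ 3 + 27 * B ^ 2 ≠ 0 := by rw [hDe]; simpa using hΔ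
  have hA : A ≠ 0 := by
    rintro rfl
    apply hj0
    have : E.c₄ = 0 := by linarith
    rw [hj, this]; simp
  have h2z : padicValRat p (6912 : ℚ) = 0 := by
    have : ((6912 : ℕ) : ℚ) = (6912 : ℚ) := by norm_num
    rw [← this, padicValRat.of_nat, padicValNat.eq_zero_of_not_dvd, Nat.cast_zero]
    intro h
    have e : 6912 = 2 ^ 8 * 3 ^ 3 := by norm_num
    rw [e, hp.dvd_mul] at h
    rcases h with h | h
    · have := Nat.le_of_dvd (by norm_num) (hp.dvd_of_dvd_pow h); omega
    · have := Nat.le_of_dvd (by norm_num) (hp.dvd_of_dvd_pow h); omega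
  have hval : padicValRat p E.j = 3 * padicValRat p A - padicValRat p (4 * A ^ 3 + 27 * B ^ 2) := by
    have e : E.j = 6912 * (A ^ 3 / (4 * A ^ 3 + 27 * B ^ 2)) := by
      rw [hj, hDe, hAdef]; field_simp; ring
    rw [e, padicValRat.mul (by norm_num) (div_ne_zero (pow_ne_zero _ hA) hD), h2z,
      padicValRat.div (pow_ne_zero _ hA) hD, padicValRat.pow]
    push_cast; ring
  have hcase : (3 ∣ padicValRat p (4 * A ^ 3 + 27 * B ^ 2) ∧
        padicValRat p (4 * A ^ 3 + 27 * B ^ 2) ≤ 3 * padicValRat p A) ∨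
      3 * padicValRat p A < padicValRat p (4 * A ^ 3 + 27 * B ^ 2) := by
    rw [hval] at hcon
    omega
  obtain ⟨m, s, c, q, hs0, hs, hA1, hB1, hred, hc⟩ := norm_step (by omega) A B hA hD hcase
  obtain ⟨ι, res, hres⟩ := pac_embed (p := p)
  obtain ⟨ξ, hξX, hξ⟩ := asm_xi E ρ hρ
  rw [← hAdef, ← hBdef] at hξX
  have himg' := himg
  obtain ⟨g, hg⟩ := himg
  have hX := XData.scale hξX ι hs0
  rw [map_ratCast, map_ratCast] at hX
  let act : (stab2 s c) →* (PadicAlgCl p ≃+* PadicAlgCl p) :=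
    { toFun := fun τ => τ.1.toRingEquiv
      map_one' := rfl
      map_mul' := fun a b => rfl }
  have hact : ∀ (τ : stab2 s c) z, act τ z = τ.1 z := fun _ _ => rfl
  have hsn : ‖s‖ ^ 2 = (p : ℝ) ^ (-padicValRat p ((p : ℚ) ^ m)) := by
    rw [← norm_pow, hs, pac_rat]
    exact zpow_ne_zero _ (by exact_mod_cast hp.ne_zero)
  have hcore : Core p act ((ρ.comp res).comp (stab2 s c).subtype) g
      ((A : PadicAlgCl p) / s ^ 2) ((B : PadicAlgCl p) / s ^ 3) c (fun v => ι (ξ v) / s) := by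
    refine ⟨hp37, hX, ?_, ?_, pac_p, hA1, hB1, hred, ?_, ?_, ?_, ?_, ?_, ?_⟩
    · have := pac_nat (p := p) 2 ((Nat.coprime_primes Nat.prime_two hp).2 (by omega)); simpa using this
    · have := pac_nat (p := p) 3 ((Nat.coprime_primes Nat.prime_three hp).2 (by omega)); simpa using this
    · intro τ z; exact pac_iso τ.1 z
    · intro z hz hf
      exact stab2_fix hs hc z hz (fun τ hτ => hf ⟨τ, hτ⟩)
    · intro τ
      rw [← hg]; exact ⟨_, rfl⟩
    · intro τ; exact τ.2.2
    · intro τ v hv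
      rw [hact, map_div₀, τ.2.1, ← hres, hξ]; rfl
    · intro R hR hw
      have hspos : 0 < ‖s‖ := norm_pos_iff.2 hs0
      obtain ⟨k, hk⟩ := asm_ss ρ himg' ξ hξ ι (R * ‖s‖) (by positivity) (by
        intro w hw0
        rw [← hw w hw0, norm_div]; field_simp)
      refine ⟨k * 2 - (-padicValRat p ((p : ℚ) ^ m)) * Nat.card (Gset p), ?_⟩
      have hpr0 : (p : ℝ) ≠ 0 := by exact_mod_cast hp.ne_zero
      rw [zpow_sub₀ hpr0, _root_.zpow_mul, _root_.zpow_mul, ← hk, ← hsn, zpow_natCast, eq_div_iff (by positivity),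
        ← pow_mul]
      norm_cast
      ring
  exact hcore.false
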